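/- Let d ≥ 3, m ≥ 0, n ≥ 1 be integers and l > 0. For every Schwartz function φ on ℝ^d one has ⟨R_d[r^{−d−2m}], Δ^n φ⟩ = [ (d+2m+2n−2)!!/(d+2m−2)!! ] · [ (2m+2n)!!/(2m)!! ] · ⟨R_d[r^{−d−2m−2n}], φ⟩ − (Ω_{d,m}/(2m)!) Σ_{ℓ=1}^{n} (4m+4ℓ+d−2)/( 2(m+ℓ)(2m+2ℓ+d−2) ) · (Δ^{n+m} φ)(0), where !! is the double factorial. (In distributional form: Δ^n R_d[r^{−d−2m}] = [(d+2m+2n−2)!!/(d+2m−2)!!][(2m+2n)!!/(2m)!!] R_d[r^{−d−2m−2n}] − (Ω_{d,m}/(2m)!) Σ_{ℓ=1}^{n} (4m+4ℓ+d−2)/(2(m+ℓ)(2m+2ℓ+d−2)) Δ^{n+m}δ.) -/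

import Mathlib

open MeasureTheory Real SchwartzMap

noncomputable section

/-- The Laplacian of a function on `ℝ^d`. -/
def lapl (d : ℕ) (f : EuclideanSpace ℝ (Fin d) → ℝ) (x : EuclideanSpace ℝ (Fin d)) : ℝ :=
  ∑ i : Fin d,
    fderiv ℝ (fun y => fderiv ℝ f y (EuclideanSpace.single i 1)) x (EuclideanSpace.single i 1)

/-- The subtraction extension `⟨R_d[r^{-d-2k}], f⟩`: the `2k`-jet of `f` at `0` is
subtracted, the top (`|α| = 2k`) Taylor term being weighted by the infrared regulator
`θ(l - |x|)`.  (The sum over multi-indices `|α| = j` of `(x^α/α!) ∂^α f(0)` equals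
`(1/j!) D^j f(0)[x,…,x]`.) -/
def subExt (d k : ℕ) (l : ℝ) (f : EuclideanSpace ℝ (Fin d) → ℝ) : ℝ :=
  ∫ x : EuclideanSpace ℝ (Fin d),
    ‖x‖ ^ (-(d : ℝ) - 2 * (k : ℝ)) *
      (f x - (∑ j ∈ Finset.range (2 * k),
          (1 / (j.factorial : ℝ)) * iteratedFDeriv ℝ j f 0 (fun _ => x))
        - (if ‖x‖ ≤ l then (1 : ℝ) else 0) * (1 / ((2 * k).factorial : ℝ)) *
            iteratedFDeriv ℝ (2 * k) f 0 (fun _ => x))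

/-- `Ω_{d,m} := 2 Γ(m + 1/2) π^{(d-1)/2} / Γ(m + d/2)`. -/
def OmegaDM (d m : ℕ) : ℝ :=
  2 * Real.Gamma ((m : ℝ) + 1 / 2) * Real.pi ^ (((d : ℝ) - 1) / 2) /
    Real.Gamma ((m : ℝ) + (d : ℝ) / 2)

section

open scoped ContDiff

open scoped ContDiff

/-- short name for the Euclidean space -/
abbrev Eu (d : ℕ) := EuclideanSpace ℝ (Fin d)

/-- partial derivative -/
def Dd (d : ℕ) (i : Fin d) (f : Eu d → ℝ) : Eu d → ℝ :=
  fun y => fderiv ℝ f y (EuclideanSpace.single i 1)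

/-- homogeneous Taylor term at the origin -/
def TT (d j : ℕ) (f : Eu d → ℝ) : Eu d → ℝ :=
  fun x => (1 / (j.factorial : ℝ)) * iteratedFDeriv ℝ j f 0 (fun _ => x)

lemma lapl_eq (d : ℕ) (f : Eu d → ℝ) : lapl d f = fun x => ∑ i, Dd d i (Dd d i f) x := rfl

lemma Dd_contDiff {d : ℕ} {i : Fin d} {f : Eu d → ℝ} (hf : ContDiff ℝ ∞ f) :
    ContDiff ℝ ∞ (Dd d i f) := by
  unfold Dd
  exact (hf.fderiv_right (m := ∞) (by simp)).clm_apply contDiff_const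

lemma TT_contDiff (d j : ℕ) (f : Eu d → ℝ) : ContDiff ℝ ∞ (TT d j f) := by
  unfold TT
  refine contDiff_const.mul ?_
  exact (iteratedFDeriv ℝ j f 0).contDiff.comp (contDiff_pi.2 fun _ => contDiff_id)

lemma eu_sum {d : ℕ} (x : Eu d) : x = ∑ i, x i • (EuclideanSpace.single i (1:ℝ) : Eu d) := by
  ext j
  simp [Finset.sum_apply, Pi.single_apply]

lemma TT_succ {d : ℕ} (j : ℕ) {f : Eu d → ℝ} (hf : ContDiff ℝ ∞ f) (x : Eu d) :
    ((j : ℝ) + 1) * TT d (j + 1) f x = ∑ i, x i * TT d j (Dd d i f) x := by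
  have h1 : iteratedFDeriv ℝ (j + 1) f 0 (fun _ => x)
      = ∑ i, x i * iteratedFDeriv ℝ j (Dd d i f) 0 (fun _ => x) := by
    rw [iteratedFDeriv_succ_apply_right]
    have h2 : ∀ i, iteratedFDeriv ℝ j (Dd d i f) 0 (fun _ => x)
      = iteratedFDeriv ℝ j (fun y => fderiv ℝ f y) 0 (fun _ => x) (EuclideanSpace.single i 1) := by
      intro i
      unfold Dd
      exact iteratedFDeriv_clm_apply_const_apply (hf.fderiv_right (m := ∞) (by simp))
        (by exact_mod_cast le_top)
    simp_rw [h2]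
    have h3 : (Fin.init fun _ : Fin (j+1) => x) = fun _ => x := rfl
    rw [h3]
    conv_lhs => rw [eu_sum x]
    rw [map_sum]
    simp [← eu_sum x]
  unfold TT
  rw [h1, Finset.mul_sum, Finset.mul_sum]
  refine Finset.sum_congr rfl fun i _ => ?_
  rw [Nat.factorial_succ]
  have : (j.factorial : ℝ) ≠ 0 := by exact_mod_cast j.factorial_ne_zero
  push_cast
  field_simp

lemma Dd_comm {d : ℕ} (i l : Fin d) {f : Eu d → ℝ} (hf : ContDiff ℝ ∞ f) :
    Dd d i (Dd d l f) = Dd d l (Dd d i f) := by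
  funext x
  have h2 : ∀ i l : Fin d, Dd d i (Dd d l f) x = fderiv ℝ (fderiv ℝ f) x (EuclideanSpace.single i 1)
      (EuclideanSpace.single l 1) := by
    intro i l
    unfold Dd
    have hd : DifferentiableAt ℝ (fderiv ℝ f) x :=
      ((hf.fderiv_right (m := ∞) (by simp)).differentiable (by simp)) x
    rw [fderiv_clm_apply hd (differentiableAt_const _)]
    simp
  rw [h2, h2]
  exact (hf.contDiffAt.isSymmSndFDerivAt (by simp only [minSmoothness_of_isRCLikeNormedField]; exact WithTop.coe_le_coe.2 le_top)) _ _

lemma Dd_sum {d : ℕ} {ι : Type*} (s : Finset ι) (i : Fin d) {f : ι → Eu d → ℝ}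
    (hf : ∀ a ∈ s, ContDiff ℝ ∞ (f a)) :
    Dd d i (fun x => ∑ a ∈ s, f a x) = fun x => ∑ a ∈ s, Dd d i (f a) x := by
  funext x
  unfold Dd
  rw [fderiv_fun_sum fun a ha => ((hf a ha).differentiable (by simp)) x]
  simp

lemma Dd_mul {d : ℕ} (i : Fin d) {f g : Eu d → ℝ}
    (hf : ContDiff ℝ ∞ f) (hg : ContDiff ℝ ∞ g) :
    Dd d i (fun x => f x * g x) = fun x => f x * Dd d i g x + Dd d i f x * g x := by
  funext x
  unfold Dd
  rw [fderiv_fun_mul (hf.differentiable (by simp) x) (hg.differentiable (by simp) x)]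
  simp [mul_comm]

lemma Dd_sub {d : ℕ} (i : Fin d) {f g : Eu d → ℝ}
    (hf : ContDiff ℝ ∞ f) (hg : ContDiff ℝ ∞ g) :
    Dd d i (fun x => f x - g x) = fun x => Dd d i f x - Dd d i g x := by
  funext x
  unfold Dd
  rw [fderiv_fun_sub (hf.differentiable (by simp) x) (hg.differentiable (by simp) x)]
  simp

lemma Dd_add {d : ℕ} (i : Fin d) {f g : Eu d → ℝ}
    (hf : ContDiff ℝ ∞ f) (hg : ContDiff ℝ ∞ g) :
    Dd d i (fun x => f x + g x) = fun x => Dd d i f x + Dd d i g x := by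
  funext x
  unfold Dd
  rw [fderiv_fun_add (hf.differentiable (by simp) x) (hg.differentiable (by simp) x)]
  simp

lemma Dd_const {d : ℕ} (i : Fin d) (c : ℝ) : Dd d i (fun _ => c) = fun _ => 0 := by
  funext x
  simp [Dd]

lemma contDiff_coord {d : ℕ} (l : Fin d) : ContDiff ℝ ∞ (fun x : Eu d => x l) :=
  (EuclideanSpace.proj (𝕜 := ℝ) l : Eu d →L[ℝ] ℝ).contDiff

lemma Dd_coord {d : ℕ} (i l : Fin d) :
    Dd d i (fun x => x l) = fun _ => if l = i then 1 else 0 := by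
  funext x
  unfold Dd
  have : HasFDerivAt (fun x : Eu d => x l) (EuclideanSpace.proj (𝕜 := ℝ) l : Eu d →L[ℝ] ℝ) x :=
    (EuclideanSpace.proj (𝕜 := ℝ) l : Eu d →L[ℝ] ℝ).hasFDerivAt
  rw [this.fderiv]
  simp

lemma TT_zero {d : ℕ} (f : Eu d → ℝ) : TT d 0 f = fun _ => f 0 := by
  funext x
  simp [TT]

lemma Dd_TT_zero {d : ℕ} (i : Fin d) (f : Eu d → ℝ) : Dd d i (TT d 0 f) = fun _ => 0 := by
  rw [TT_zero, Dd_const]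

lemma Dd_TT {d : ℕ} (j : ℕ) : ∀ {f : Eu d → ℝ} (_ : ContDiff ℝ ∞ f) (l : Fin d),
    Dd d l (TT d (j + 1) f) = TT d j (Dd d l f) := by
  induction j with
  | zero =>
    intro f hf l
    have h : TT d 1 f = fun x => ∑ i, x i * TT d 0 (Dd d i f) x := by
      funext x
      have := TT_succ 0 hf x
      simpa using this
    rw [zero_add, h, Dd_sum _ _ (fun i _ => (contDiff_coord i).mul (TT_contDiff _ _ _))]
    funext x
    simp_rw [fun i => Dd_mul l (contDiff_coord i) (TT_contDiff d 0 (Dd d i f)), Dd_coord,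
      Dd_TT_zero]
    simp
  | succ j ih =>
    intro f hf l
    have h : TT d (j+2) f = fun x => ((j:ℝ)+2)⁻¹ * ∑ i, x i * TT d (j+1) (Dd d i f) x := by
      funext x
      have := TT_succ (j+1) hf x
      push_cast at this
      rw [← this]
      have : (j:ℝ) + 2 ≠ 0 := by positivity
      field_simp
      ring
    have hs : ∀ i, ContDiff ℝ ∞ (fun x : Eu d => x i * TT d (j+1) (Dd d i f) x) :=
      fun i => (contDiff_coord i).mul (TT_contDiff _ _ _)
    rw [h, Dd_mul _ contDiff_const (ContDiff.sum fun i _ => hs i), Dd_const,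
      Dd_sum _ _ (fun i _ => hs i)]
    funext x
    simp_rw [fun i => Dd_mul l (contDiff_coord i) (TT_contDiff d (j+1) (Dd d i f)), Dd_coord]
    simp_rw [fun i => ih (Dd_contDiff (i := i) hf) l, fun i => Dd_comm l i hf]
    rw [Finset.sum_add_distrib, ← TT_succ j (Dd_contDiff hf) x]
    simp
    have : (j:ℝ) + 2 ≠ 0 := by positivity
    field_simp
    ring

lemma TT_smul {d : ℕ} (j : ℕ) (f : Eu d → ℝ) (c : ℝ) (x : Eu d) :
    TT d j f (c • x) = c ^ j * TT d j f x := by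
  unfold TT
  have := (iteratedFDeriv ℝ j f 0).map_smul_univ (fun _ => c) (fun _ => x)
  simp at this
  rw [this]; ring

lemma TT_bound {d : ℕ} (j : ℕ) (f : Eu d → ℝ) : ∃ C, 0 ≤ C ∧ ∀ x, |TT d j f x| ≤ C * ‖x‖ ^ j := by
  refine ⟨(1 / (j.factorial : ℝ)) * ‖iteratedFDeriv ℝ j f 0‖, by positivity, fun x => ?_⟩
  unfold TT
  rw [abs_mul, abs_of_nonneg (by positivity : 0 ≤ 1 / (j.factorial : ℝ)), mul_assoc]
  gcongr
  have := (iteratedFDeriv ℝ j f 0).le_opNorm (fun _ => x)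
  simpa using this

lemma TT_sum {d : ℕ} {ι : Type*} (s : Finset ι) (j : ℕ) {f : ι → Eu d → ℝ}
    (hf : ∀ a ∈ s, ContDiff ℝ ∞ (f a)) :
    TT d j (fun x => ∑ a ∈ s, f a x) = fun x => ∑ a ∈ s, TT d j (f a) x := by
  funext x
  unfold TT
  rw [iteratedFDeriv_fun_sum_apply fun a ha => ((hf a ha).of_le (by exact_mod_cast le_top)).contDiffAt]
  simp [Finset.mul_sum]

lemma TT_lapl {d : ℕ} (j : ℕ) {f : Eu d → ℝ} (hf : ContDiff ℝ ∞ f) :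
    TT d j (lapl d f) = lapl d (TT d (j + 2) f) := by
  rw [lapl_eq, lapl_eq, TT_sum _ _ fun i _ => Dd_contDiff (Dd_contDiff hf)]
  funext x
  refine Finset.sum_congr rfl fun i _ => ?_
  rw [Dd_TT _ hf, Dd_TT _ (Dd_contDiff hf)]

lemma taylor_bound {d : ℕ} (N : ℕ) {f : Eu d → ℝ} (hf : ContDiff ℝ ∞ f) :
    ∃ C, 0 ≤ C ∧ ∀ x, ‖x‖ ≤ 1 →
      |f x - ∑ j ∈ Finset.range (N + 1), TT d j f x| ≤ C * ‖x‖ ^ (N + 1) := by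
  have hc : Continuous (iteratedFDeriv ℝ (N+1) f) :=
    hf.continuous_iteratedFDeriv (by exact_mod_cast le_top)
  obtain ⟨C, hC⟩ := (isCompact_closedBall (0 : Eu d) 1).exists_bound_of_continuousOn hc.continuousOn
  have hC0 : 0 ≤ C := (norm_nonneg _).trans (hC 0 (by simp))
  refine ⟨C, hC0, fun x hx => ?_⟩
  have h := map_add_eq_sum_add_integral_iteratedFDeriv (f := f) (x := 0) (y := x) (n := N)
    (fun t _ => (hf.of_le (by exact_mod_cast le_top)).contDiffAt)
  simp only [zero_add, smul_eq_mul] at h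
  unfold TT
  simp only [one_div]
  rw [h, add_sub_cancel_left, abs_mul]
  have h1 : |((N.factorial : ℝ))⁻¹| ≤ 1 := by
    rw [abs_of_nonneg (by positivity)]
    exact inv_le_one_of_one_le₀ (by exact_mod_cast N.factorial_pos)
  have h2 : ‖∫ t in (0:ℝ)..1, (1 - t) ^ N * iteratedFDeriv ℝ (N + 1) f (t • x) (fun _ => x)‖
      ≤ (C * ‖x‖ ^ (N+1)) * |1 - 0| := by
    refine intervalIntegral.norm_integral_le_of_norm_le_const fun t ht => ?_
    rw [Set.uIoc_of_le zero_le_one] at ht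
    rw [norm_mul]
    have h3 : ‖(1 - t) ^ N‖ ≤ 1 := by
      rw [norm_pow, Real.norm_eq_abs, abs_of_nonneg (by linarith [ht.2])]
      exact pow_le_one₀ (by linarith [ht.2]) (by linarith [ht.1])
    have h4 : ‖iteratedFDeriv ℝ (N + 1) f (t • x) (fun _ => x)‖ ≤ C * ‖x‖ ^ (N+1) := by
      refine ((iteratedFDeriv ℝ (N + 1) f (t • x)).le_opNorm _).trans ?_
      simp only [Finset.prod_const, Finset.card_univ, Fintype.card_fin]
      gcongr
      apply hC
      simp only [Metric.mem_closedBall, dist_zero_right, norm_smul, Real.norm_eq_abs]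
      rw [abs_of_nonneg ht.1.le]
      nlinarith [ht.1, ht.2, norm_nonneg x]
    nlinarith [norm_nonneg (iteratedFDeriv ℝ (N + 1) f (t • x) (fun _ => x))]
  rw [Real.norm_eq_abs] at h2
  simp at h2
  calc _ ≤ 1 * (C * ‖x‖ ^ (N+1)) := by gcongr
    _ = _ := one_mul _

end

section

open scoped ContDiff

open Set Filter Topology in
lemma polar_int {d : ℕ} (hd : 0 < d) (F : ℝ → ℝ) (q : Eu d → ℝ) (j : ℕ)
    (hq : ∀ (c : ℝ) x, q (c • x) = c ^ j * q x) :
    ∫ x : Eu d, F ‖x‖ * q x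
      = (∫ w, q w.1 ∂(volume : Measure (Eu d)).toSphere) *
        ∫ r in Ioi (0:ℝ), r ^ (d - 1) * (F r * r ^ j) := by
  have : Nonempty (Fin d) := ⟨⟨0, hd⟩⟩
  have : Nontrivial (Eu d) := inferInstance
  set μ : Measure (Eu d) := volume
  have hdim : Module.finrank ℝ (Eu d) = d := by simp
  calc
    ∫ x, F ‖x‖ * q x ∂μ = ∫ x : ({(0)}ᶜ : Set (Eu d)), F ‖x.1‖ * q x.1 ∂(μ.comap (↑)) := by
      rw [integral_subtype_comap (measurableSet_singleton _).compl fun x ↦ F (‖x‖) * q x,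
        restrict_compl_singleton]
    _ = ∫ x, q x.1.1 * (F x.2.1 * x.2.1 ^ j) ∂μ.toSphere.prod (.volumeIoiPow (Module.finrank ℝ (Eu d) - 1)) := by
      rw [← μ.measurePreserving_homeomorphUnitSphereProd.integral_comp
        (Homeomorph.measurableEmbedding _)]
      congr 1
      funext x
      have hx : ‖x.1‖ ≠ 0 := norm_ne_zero_iff.2 x.2
      simp only [homeomorphUnitSphereProd_apply_snd_coe, homeomorphUnitSphereProd_apply_fst_coe]
      rw [hq, inv_pow]
      field_simp
    _ = (∫ w, q w.1 ∂μ.toSphere) * ∫ x : Ioi (0 : ℝ), (F x.1 * x.1 ^ j) ∂.volumeIoiPow (Module.finrank ℝ (Eu d) - 1) :=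
      integral_prod_mul (fun w : Metric.sphere (0 : Eu d) 1 => q w.1)
        (fun r : Ioi (0:ℝ) => F r.1 * r.1 ^ j)
    _ = _ := by
      simp only [Measure.volumeIoiPow, ENNReal.ofReal]
      rw [integral_withDensity_eq_integral_smul, hdim,
        integral_subtype_comap measurableSet_Ioi fun a ↦ Real.toNNReal (a ^ (d - 1)) • (F a * a ^ j),
        setIntegral_congr_fun measurableSet_Ioi fun x hx ↦ ?_]
      · rw [NNReal.smul_def, Real.coe_toNNReal _ (pow_nonneg (mem_Ioi.1 hx).le _), smul_eq_mul]
      · exact (measurable_subtype_coe.pow_const _).real_toNNReal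

/-- dominating weight -/
def wt (d : ℕ) (x : Eu d) : ℝ := ‖x‖ ^ (-(d:ℝ)) * min ‖x‖ ‖x‖⁻¹

open Set Filter Topology in
lemma min_one_integrable : IntegrableOn (fun y : ℝ => min 1 (y⁻¹ ^ 2)) (Ioi 0) := by
  rw [← Ioc_union_Ioi_eq_Ioi (zero_le_one : (0:ℝ) ≤ 1)]
  refine IntegrableOn.union ?_ ?_
  · refine (integrableOn_const (C := (1:ℝ)) (by simp)).congr_fun ?_ measurableSet_Ioc
    intro y hy
    have : 1 ≤ y⁻¹ := (one_le_inv₀ hy.1).2 hy.2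
    simp only
    rw [min_eq_left (one_le_pow₀ this)]
  · refine (integrableOn_Ioi_rpow_of_lt (a := -2) (by norm_num) zero_lt_one).congr_fun ?_ measurableSet_Ioi
    intro y hy
    have hy' : (0:ℝ) < y := zero_lt_one.trans hy
    have : y⁻¹ ≤ 1 := inv_le_one_of_one_le₀ (mem_Ioi.1 hy).le
    simp only
    rw [min_eq_right (pow_le_one₀ (by positivity) this), Real.rpow_neg hy'.le]
    simp

open Set Filter Topology in
lemma wt_integrable {d : ℕ} (hd : 0 < d) : Integrable (wt d) := by
  have : Nonempty (Fin d) := ⟨⟨0, hd⟩⟩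
  have : Nontrivial (Eu d) := inferInstance
  have hdim : Module.finrank ℝ (Eu d) = d := by simp
  have := (integrable_fun_norm_addHaar (volume : Measure (Eu d))
    (f := fun y : ℝ => y ^ (-(d:ℝ)) * min y y⁻¹)).2 ?_
  · exact this
  refine min_one_integrable.congr_fun ?_ measurableSet_Ioi
  intro y hy
  have hy' : (0:ℝ) < y := hy
  simp only [hdim, smul_eq_mul]
  have h1 : y ^ (d - 1) * y ^ (-(d:ℝ)) = y⁻¹ := by
    rw [Real.rpow_neg hy'.le, Real.rpow_natCast]
    obtain ⟨n, rfl⟩ : ∃ n, d = n + 1 := ⟨d - 1, by omega⟩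
    simp only [Nat.add_sub_cancel]
    field_simp
    ring
  rw [← mul_assoc, h1, mul_min_of_nonneg _ _ (by positivity), inv_mul_cancel₀ hy'.ne']
  ring_nf

open Set Filter Topology in
lemma div_zero_int {d : ℕ} (hd : 2 ≤ d) (i : Fin d) (F F' : Eu d → ℝ)
    (hF : ∀ x, x ≠ 0 → HasLineDerivAt ℝ F (F' x) x (EuclideanSpace.single i 1))
    (hInt : Integrable F') (C : ℝ) (hC : ∀ x, 1 ≤ ‖x‖ → |F x| ≤ C * ‖x‖⁻¹) :
    ∫ x, F' x = 0 := by
  obtain ⟨n, rfl⟩ : ∃ n, d = n + 1 := ⟨d - 1, by omega⟩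
  have : Nonempty (Fin n) := ⟨⟨0, by omega⟩⟩
  set e : ℝ × (Fin n → ℝ) ≃ᵐ (Fin (n+1) → ℝ) := (MeasurableEquiv.piFinSuccAbove (fun _ => ℝ) i).symm
  have hem : MeasurePreserving e :=
    (volume_preserving_piFinSuccAbove (fun _ : Fin (n + 1) => ℝ) i).symm _
  have hme : MeasurableEmbedding (WithLp.toLp 2 : (Fin (n+1) → ℝ) → Eu (n+1)) :=
    (MeasurableEquiv.toLp 2 (Fin (n+1) → ℝ)).measurableEmbedding
  have hp : MeasurePreserving (WithLp.toLp 2 : (Fin (n+1) → ℝ) → Eu (n+1)) :=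
    PiLp.volume_preserving_toLp (Fin (n+1))
  rw [← hp.integral_comp hme, ← hem.integral_comp e.measurableEmbedding]
  have hint2 : Integrable (fun z : ℝ × (Fin n → ℝ) => F' (WithLp.toLp 2 (e z))) := by
    have h1 := (hp.integrable_comp_emb hme).2 hInt
    exact (hem.integrable_comp_emb e.measurableEmbedding).2 h1
  rw [Measure.volume_eq_prod] at hint2 ⊢
  rw [integral_prod_symm _ hint2]
  have hne : ∀ᵐ y : Fin n → ℝ, y ≠ 0 := by
    simp [ae_iff]
  apply integral_eq_zero_of_ae
  filter_upwards [hne, hint2.prod_left_ae] with y hy hyi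
  have hev : ∀ t : ℝ, e (t, y) = i.insertNth t y := fun t => rfl
  have hnz : ∀ t : ℝ, (WithLp.toLp 2 (e (t, y)) : Eu (n+1)) ≠ 0 := by
    intro t h0
    apply hy
    funext k
    have := congrArg (fun v : Eu (n+1) => v (i.succAbove k)) h0
    simpa [hev] using this
  have hnorm : ∀ t : ℝ, |t| ≤ ‖(WithLp.toLp 2 (e (t, y)) : Eu (n+1))‖ := by
    intro t
    have := PiLp.norm_apply_le (WithLp.toLp 2 (e (t, y)) : Eu (n+1)) i
    simpa [hev] using this
  have hder : ∀ t : ℝ, HasDerivAt (fun t => F (WithLp.toLp 2 (e (t, y))))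
      (F' (WithLp.toLp 2 (e (t, y)))) t := by
    intro t
    have h1 := hF _ (hnz t)
    have h2 : ∀ s : ℝ, (WithLp.toLp 2 (e (s, y)) : Eu (n+1))
        = WithLp.toLp 2 (e (t, y)) + (s - t) • EuclideanSpace.single i 1 := by
      intro s
      ext k
      rcases Fin.eq_self_or_eq_succAbove i k with rfl | ⟨k, rfl⟩
      · simp [hev]
      · simp [hev]
    have h3 : HasDerivAt (fun s : ℝ => F (WithLp.toLp 2 (e (t, y)) + s • EuclideanSpace.single i 1))
      (F' (WithLp.toLp 2 (e (t, y)))) (t - t) := by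
      rw [sub_self]; exact h1
    have h4 := h3.comp_sub_const t t
    simpa only [← h2] using h4
  have hbd : ∀ t : ℝ, 1 ≤ |t| → ‖F (WithLp.toLp 2 (e (t, y)))‖ ≤ |C| * |t|⁻¹ := by
    intro t ht
    have h0 : 0 < |t| := by linarith
    have hn := hnorm t
    refine (hC _ (ht.trans hn)).trans ?_
    have : ‖(WithLp.toLp 2 (e (t, y)) : Eu (n+1))‖⁻¹ ≤ |t|⁻¹ := inv_anti₀ h0 hn
    calc _ ≤ |C| * ‖(WithLp.toLp 2 (e (t, y)) : Eu (n+1))‖⁻¹ := by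
            gcongr; exact le_abs_self C
      _ ≤ _ := by gcongr
  have htop : Tendsto (fun t => F (WithLp.toLp 2 (e (t, y)))) atTop (𝓝 0) := by
    refine squeeze_zero_norm' (a := fun t => |C| * |t|⁻¹) ?_ ?_
    · filter_upwards [tendsto_abs_atTop_atTop.eventually_ge_atTop 1] with t ht using hbd t ht
    · simpa using (tendsto_inv_atTop_zero.comp tendsto_abs_atTop_atTop).const_mul |C|
  have hbot : Tendsto (fun t => F (WithLp.toLp 2 (e (t, y)))) atBot (𝓝 0) := by
    refine squeeze_zero_norm' (a := fun t => |C| * |t|⁻¹) ?_ ?_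
    · filter_upwards [tendsto_abs_atBot_atTop.eventually_ge_atTop 1] with t ht using hbd t ht
    · simpa using (tendsto_inv_atTop_zero.comp tendsto_abs_atBot_atTop).const_mul |C|
  simpa using integral_of_hasDerivAt_of_tendsto hder hyi hbot htop

end

section

open scoped ContDiff

lemma norm_rpow_line {d : ℕ} (a : ℝ) (i : Fin d) {x : Eu d} (hx : x ≠ 0) :
    HasLineDerivAt ℝ (fun y : Eu d => ‖y‖ ^ a) (a * x i * ‖x‖ ^ (a - 2)) x
      (EuclideanSpace.single i 1) := by
  have hx0 : 0 < ‖x‖ := norm_pos_iff.2 hx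
  have h1 : HasFDerivAt (fun y : Eu d => ‖y‖ ^ 2) (2 • (innerSL ℝ x)) x :=
    (hasStrictFDerivAt_norm_sq x).hasFDerivAt
  have h2 := (h1.hasLineDerivAt (EuclideanSpace.single i 1))
  have h3 : HasDerivAt (fun t : ℝ => ‖x + t • (EuclideanSpace.single i 1 : Eu d)‖ ^ 2) (2 * x i) 0 := by
    have h2' : HasDerivAt (fun t : ℝ => ‖x + t • (EuclideanSpace.single i 1 : Eu d)‖ ^ 2) _ 0 := h2
    refine h2'.congr_deriv ?_
    simp [EuclideanSpace.inner_single_right]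
  have h4 := h3.rpow_const (p := a / 2) (by left; simp [hx])
  unfold HasLineDerivAt
  have h5 : ∀ z : Eu d, (‖z‖ ^ 2) ^ (a / 2) = ‖z‖ ^ a := by
    intro z
    rw [← Real.rpow_natCast, ← Real.rpow_mul (norm_nonneg z)]
    congr 1; push_cast; ring
  simp only [h5] at h4
  refine h4.congr_deriv ?_
  simp only [zero_smul, add_zero]
  have h6 : (‖x‖ ^ 2) ^ (a / 2 - 1) = ‖x‖ ^ (a - 2) := by
    rw [← Real.rpow_natCast, ← Real.rpow_mul (norm_nonneg x)]
    congr 1; push_cast; ring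
  rw [h6]; ring

lemma Dd_line {d : ℕ} (i : Fin d) {f : Eu d → ℝ} (hf : ContDiff ℝ ∞ f) (x : Eu d) :
    HasLineDerivAt ℝ f (Dd d i f x) x (EuclideanSpace.single i 1) :=
  ((hf.differentiable (by simp)) x).hasFDerivAt.hasLineDerivAt _

/-- weight controlling the functions to which partial integration is applied -/
def Wt (d k : ℕ) (x : Eu d) : ℝ := ‖x‖ ^ (2 * k + 2) * min ‖x‖ ‖x‖⁻¹

lemma Wt_nonneg (d k : ℕ) (x : Eu d) : 0 ≤ Wt d k x := by
  unfold Wt; positivity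

lemma wt_Wt {d k : ℕ} {x : Eu d} (hx : x ≠ 0) :
    ‖x‖ ^ (-(d:ℝ) - 2 * k - 2) * Wt d k x = wt d x := by
  have hx0 : 0 < ‖x‖ := norm_pos_iff.2 hx
  unfold wt Wt
  rw [← mul_assoc, ← Real.rpow_natCast, ← Real.rpow_add hx0]
  congr 2; push_cast; ring

lemma integrable_of_wt {d : ℕ} (hd : 0 < d) {f : Eu d → ℝ} (hf : Measurable f) (C : ℝ)
    (h : ∀ x, x ≠ 0 → |f x| ≤ C * wt d x) : Integrable f := by
  refine ((wt_integrable hd).const_mul C).mono' hf.aestronglyMeasurable ?_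
  have : Nonempty (Fin d) := ⟨⟨0, hd⟩⟩
  have : Nontrivial (Eu d) := inferInstance
  have h0 : ∀ᵐ x : Eu d, x ≠ 0 := by simp [ae_iff]
  filter_upwards [h0] with x hx using h x hx

lemma abs_coord_le {d : ℕ} (x : Eu d) (i : Fin d) : |x i| ≤ ‖x‖ := by
  simpa using PiLp.norm_apply_le x i

lemma ibp {d k : ℕ} (hd : 3 ≤ d) {G : Eu d → ℝ} (hG : ContDiff ℝ ∞ G) (C : ℝ)
    (h0 : ∀ x, |G x| ≤ C * Wt d k x)
    (h1 : ∀ i x, ‖x‖ * |Dd d i G x| ≤ C * Wt d k x)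
    (h2 : ∀ i x, ‖x‖ ^ 2 * |Dd d i (Dd d i G) x| ≤ C * Wt d k x) :
    Integrable (fun x => ‖x‖ ^ (-(d:ℝ) - 2 * k) * lapl d G x) ∧
    Integrable (fun x => ‖x‖ ^ (-(d:ℝ) - 2 * k - 2) * G x) ∧
    ∫ x, ‖x‖ ^ (-(d:ℝ) - 2 * k) * lapl d G x
      = (d + 2 * k) * (2 * k + 2) * ∫ x, ‖x‖ ^ (-(d:ℝ) - 2 * k - 2) * G x := by
  have hd0 : 0 < d := by omega
  set s : ℝ := (d:ℝ) + 2 * k with hs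
  have hs0 : 0 ≤ s := by positivity
  have es : -(d:ℝ) - 2 * k = -s := by rw [hs]; ring
  have hcG : Continuous G := hG.continuous
  have hcD : ∀ i, Continuous (Dd d i G) := fun i => (Dd_contDiff hG).continuous
  have hcDD : ∀ i, Continuous (Dd d i (Dd d i G)) := fun i => (Dd_contDiff (Dd_contDiff hG)).continuous
  have hw : ∀ x : Eu d, x ≠ 0 → ‖x‖ ^ (-s - 2) * Wt d k x = wt d x := by
    intro x hx; rw [← es]; exact wt_Wt hx
  -- the basic bounds
  have b0 : ∀ x : Eu d, x ≠ 0 → ‖x‖ ^ (-s-2) * |G x| ≤ C * wt d x := by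
    intro x hx
    rw [← hw x hx]
    have := mul_le_mul_of_nonneg_left (h0 x) (Real.rpow_nonneg (norm_nonneg x) (-s-2))
    linarith
  have b1 : ∀ i, ∀ x : Eu d, x ≠ 0 → ‖x‖ ^ (-s-2) * (‖x‖ * |Dd d i G x|) ≤ C * wt d x := by
    intro i x hx
    rw [← hw x hx]
    have := mul_le_mul_of_nonneg_left (h1 i x) (Real.rpow_nonneg (norm_nonneg x) (-s-2))
    linarith
  have b2 : ∀ i, ∀ x : Eu d, x ≠ 0 → ‖x‖ ^ (-s-2) * (‖x‖^2 * |Dd d i (Dd d i G) x|) ≤ C * wt d x := by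
    intro i x hx
    rw [← hw x hx]
    have := mul_le_mul_of_nonneg_left (h2 i x) (Real.rpow_nonneg (norm_nonneg x) (-s-2))
    linarith
  have p2 : ∀ x : Eu d, x ≠ 0 → ‖x‖ ^ (-s) = ‖x‖ ^ (-s-2) * ‖x‖ ^ 2 := by
    intro x hx
    have hx0 : 0 < ‖x‖ := norm_pos_iff.2 hx
    rw [← Real.rpow_natCast, ← Real.rpow_add hx0]; congr 1; push_cast; ring
  have p4 : ∀ x : Eu d, x ≠ 0 → ‖x‖ ^ (-s-2) = ‖x‖ ^ (-s-2-2) * ‖x‖ ^ 2 := by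
    intro x hx
    have hx0 : 0 < ‖x‖ := norm_pos_iff.2 hx
    rw [← Real.rpow_natCast, ← Real.rpow_add hx0]; congr 1; push_cast; ring
  have i0 : Integrable (fun x : Eu d => ‖x‖ ^ (-s - 2) * G x) := by
    refine integrable_of_wt hd0 (by fun_prop) C fun x hx => ?_
    rw [abs_mul, abs_of_nonneg (by positivity)]
    exact b0 x hx
  have i2 : ∀ i, Integrable (fun x : Eu d => ‖x‖ ^ (-s) * Dd d i (Dd d i G) x) := by
    intro i
    refine integrable_of_wt hd0 (by have := (hcDD i).measurable; fun_prop) C fun x hx => ?_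
    rw [abs_mul, abs_of_nonneg (by positivity), p2 x hx, mul_assoc]
    exact b2 i x hx
  have i1 : ∀ i, Integrable (fun x : Eu d => (x i) ^ 2 * ‖x‖ ^ (-s - 2 - 2) * G x) := by
    intro i
    have := hcG.measurable
    refine integrable_of_wt hd0 (by fun_prop) C fun x hx => ?_
    refine le_trans ?_ (b0 x hx)
    rw [abs_mul, p4 x hx, abs_mul, abs_of_nonneg (by positivity : 0 ≤ ‖x‖ ^ (-s-2-2)), abs_pow,
      mul_comm (‖x‖ ^ (-s-2-2))]
    have := abs_coord_le x i
    gcongr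
  -- the divergence
  set F' : Fin d → Eu d → ℝ := fun i x => ‖x‖ ^ (-s) * Dd d i (Dd d i G) x
    + s * (‖x‖ ^ (-s - 2) * G x) - s * (s + 2) * ((x i) ^ 2 * ‖x‖ ^ (-s - 2 - 2) * G x) with hF'
  have iF' : ∀ i, Integrable (F' i) := fun i =>
    ((i2 i).add (i0.const_mul s)).sub ((i1 i).const_mul (s * (s+2)))
  have key : ∀ i, ∫ x, F' i x = 0 := by
    intro i
    refine div_zero_int (by omega) i
      (fun x => ‖x‖ ^ (-s) * Dd d i G x + s * (x i * ‖x‖ ^ (-s-2) * G x)) (F' i) ?_ (iF' i)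
      (C + s * C) ?_
    · intro x hx
      have e1 : HasDerivAt _ _ _ := norm_rpow_line (-s) i hx
      have e2 : HasDerivAt _ _ _ := norm_rpow_line (-s-2) i hx
      have e3 : HasDerivAt _ _ _ := Dd_line i hG x
      have e4 : HasDerivAt _ _ _ := Dd_line i (Dd_contDiff (i := i) hG) x
      have e5 : HasDerivAt _ _ _ := Dd_line i (contDiff_coord i) x
      rw [Dd_coord] at e5
      have := (e1.mul e4).add (((e5.mul e2).mul e3).const_mul s)
      unfold HasLineDerivAt
      refine this.congr_deriv ?_
      simp only [zero_smul, add_zero, if_true, hF']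
      simp only [p2 x hx, p4 x hx, Pi.mul_apply, zero_smul, add_zero]
      ring
    · intro x hx
      have hx1 : x ≠ 0 := by
        rintro rfl; simp at hx; linarith
      have hx0 : 0 < ‖x‖ := by linarith
      have hC : 0 ≤ C * wt d x := le_trans (by positivity) (b0 x hx1)
      have hwx : ‖x‖ * wt d x ≤ ‖x‖⁻¹ := by
        unfold wt
        rw [min_eq_right (by exact (inv_le_one_of_one_le₀ hx).trans hx)]
        have : ‖x‖ ^ (-(d:ℝ)) ≤ ‖x‖ ^ (-1:ℝ) := by
          apply Real.rpow_le_rpow_of_exponent_le hx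
          have : (1:ℝ) ≤ d := by exact_mod_cast hd0
          linarith
        rw [Real.rpow_neg_one] at this
        calc ‖x‖ * (‖x‖ ^ (-(d:ℝ)) * ‖x‖⁻¹) = ‖x‖ ^ (-(d:ℝ)) := by field_simp
          _ ≤ _ := this
      have hwp : 0 < wt d x := by unfold wt; positivity
      have hC0 : 0 ≤ C := nonneg_of_mul_nonneg_left hC hwp
      have t1 : |‖x‖ ^ (-s) * Dd d i G x| ≤ ‖x‖ * (C * wt d x) := by
        rw [abs_mul, abs_of_nonneg (by positivity), p2 x hx1]
        calc _ = ‖x‖ * (‖x‖ ^ (-s-2) * (‖x‖ * |Dd d i G x|)) := by ring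
          _ ≤ _ := mul_le_mul_of_nonneg_left (b1 i x hx1) hx0.le
      have t2 : |x i * ‖x‖ ^ (-s-2) * G x| ≤ ‖x‖ * (C * wt d x) := by
        rw [mul_assoc, abs_mul, abs_mul, abs_of_nonneg (by positivity : 0 ≤ ‖x‖ ^ (-s-2))]
        exact mul_le_mul (abs_coord_le x i) (b0 x hx1) (by positivity) hx0.le
      calc _ ≤ |‖x‖ ^ (-s) * Dd d i G x| + |s * (x i * ‖x‖ ^ (-s-2) * G x)| := abs_add_le _ _
        _ ≤ ‖x‖ * (C * wt d x) + s * (‖x‖ * (C * wt d x)) := by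
            rw [abs_mul s, abs_of_nonneg hs0]; gcongr
        _ = (C + s * C) * (‖x‖ * wt d x) := by ring
        _ ≤ _ := by gcongr
  rw [es]
  have hL : (fun x : Eu d => ‖x‖ ^ (-s) * lapl d G x)
      = fun x => ∑ i, ‖x‖ ^ (-s) * Dd d i (Dd d i G) x := by
    funext x
    rw [lapl_eq, Finset.mul_sum]
  refine ⟨?_, i0, ?_⟩
  · rw [hL]
    exact integrable_finsetSum _ fun i _ => i2 i
  · have hsum : ∑ i, ∫ x, F' i x = 0 := Finset.sum_eq_zero fun i _ => key i
    rw [← integral_finsetSum _ fun i _ => iF' i] at hsum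
    have hpt : (fun x : Eu d => ∑ i, F' i x) =ᵐ[volume] fun x => ‖x‖ ^ (-s) * lapl d G x
        - (s * (2 * k + 2)) * (‖x‖ ^ (-s-2) * G x) := by
      have : Nonempty (Fin d) := ⟨⟨0, hd0⟩⟩
      have : Nontrivial (Eu d) := inferInstance
      have h0 : ∀ᵐ x : Eu d, x ≠ 0 := by simp [ae_iff]
      filter_upwards [h0] with x hx
      simp only [hF']
      have hn : ∑ i, x i ^ 2 = ‖x‖ ^ 2 := by
        rw [EuclideanSpace.norm_sq_eq]; simp
      have hS : ∑ i, s * (s + 2) * (x i ^ 2 * ‖x‖ ^ (-s - 2 - 2) * G x)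
          = s * (s + 2) * (‖x‖ ^ (-s - 2) * G x) := by
        rw [← Finset.mul_sum, ← Finset.sum_mul, ← Finset.sum_mul, hn, p4 x hx]
        ring
      rw [congrFun hL x, Finset.sum_sub_distrib, Finset.sum_add_distrib, hS]
      simp only [Finset.sum_const, Finset.card_univ, Fintype.card_fin, nsmul_eq_mul]
      have hk : (2 * k : ℝ) = s - d := by rw [hs]; ring
      rw [hk]
      ring
    rw [integral_congr_ae hpt, integral_sub, integral_const_mul] at hsum
    · linarith
    · rw [hL]
      exact integrable_finsetSum _ fun i _ => i2 i
    · exact i0.const_mul _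

end

section

open scoped ContDiff

/-- order of vanishing at the origin -/
def NZ (d a : ℕ) (f : Eu d → ℝ) : Prop := ∃ C, 0 ≤ C ∧ ∀ x, ‖x‖ ≤ 1 → |f x| ≤ C * ‖x‖ ^ a

/-- growth order at infinity -/
def FI (d : ℕ) (b : ℤ) (f : Eu d → ℝ) : Prop := ∃ C, 0 ≤ C ∧ ∀ x, 1 ≤ ‖x‖ → |f x| ≤ C * ‖x‖ ^ b

lemma NZ.add {d a : ℕ} {f g : Eu d → ℝ} (hf : NZ d a f) (hg : NZ d a g) :
    NZ d a (fun x => f x + g x) := by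
  obtain ⟨C, hC, h⟩ := hf
  obtain ⟨D, hD, h'⟩ := hg
  refine ⟨C + D, by positivity, fun x hx => (abs_add_le _ _).trans ?_⟩
  rw [add_mul]
  exact add_le_add (h x hx) (h' x hx)

lemma NZ.sub {d a : ℕ} {f g : Eu d → ℝ} (hf : NZ d a f) (hg : NZ d a g) :
    NZ d a (fun x => f x - g x) := by
  obtain ⟨C, hC, h⟩ := hf
  obtain ⟨D, hD, h'⟩ := hg
  refine ⟨C + D, by positivity, fun x hx => (abs_sub _ _).trans ?_⟩
  rw [add_mul]
  exact add_le_add (h x hx) (h' x hx)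

lemma NZ.mul {d a b : ℕ} {f g : Eu d → ℝ} (hf : NZ d a f) (hg : NZ d b g) :
    NZ d (a + b) (fun x => f x * g x) := by
  obtain ⟨C, hC, h⟩ := hf
  obtain ⟨D, hD, h'⟩ := hg
  refine ⟨C * D, by positivity, fun x hx => ?_⟩
  rw [abs_mul, pow_add]
  calc _ ≤ (C * ‖x‖ ^ a) * (D * ‖x‖ ^ b) :=
        mul_le_mul (h x hx) (h' x hx) (abs_nonneg _) (by positivity)
    _ = _ := by ring

lemma NZ.mono {d a b : ℕ} {f : Eu d → ℝ} (hf : NZ d a f) (hab : b ≤ a) : NZ d b f := by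
  obtain ⟨C, hC, h⟩ := hf
  refine ⟨C, hC, fun x hx => (h x hx).trans ?_⟩
  gcongr 1
  exact pow_le_pow_of_le_one (norm_nonneg x) hx hab

lemma NZ.const (d : ℕ) (c : ℝ) : NZ d 0 (fun _ => c) := ⟨|c|, abs_nonneg c, by simp⟩

lemma FI.add {d : ℕ} {a : ℤ} {f g : Eu d → ℝ} (hf : FI d a f) (hg : FI d a g) :
    FI d a (fun x => f x + g x) := by
  obtain ⟨C, hC, h⟩ := hf
  obtain ⟨D, hD, h'⟩ := hg
  refine ⟨C + D, by positivity, fun x hx => (abs_add_le _ _).trans ?_⟩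
  rw [add_mul]
  exact add_le_add (h x hx) (h' x hx)

lemma FI.sub {d : ℕ} {a : ℤ} {f g : Eu d → ℝ} (hf : FI d a f) (hg : FI d a g) :
    FI d a (fun x => f x - g x) := by
  obtain ⟨C, hC, h⟩ := hf
  obtain ⟨D, hD, h'⟩ := hg
  refine ⟨C + D, by positivity, fun x hx => (abs_sub _ _).trans ?_⟩
  rw [add_mul]
  exact add_le_add (h x hx) (h' x hx)

lemma FI.mul {d : ℕ} {a b : ℤ} {f g : Eu d → ℝ} (hf : FI d a f) (hg : FI d b g) :
    FI d (a + b) (fun x => f x * g x) := by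
  obtain ⟨C, hC, h⟩ := hf
  obtain ⟨D, hD, h'⟩ := hg
  refine ⟨C * D, by positivity, fun x hx => ?_⟩
  have hx0 : ‖x‖ ≠ 0 := by positivity
  rw [abs_mul, zpow_add₀ hx0]
  calc _ ≤ (C * ‖x‖ ^ a) * (D * ‖x‖ ^ b) :=
        mul_le_mul (h x hx) (h' x hx) (abs_nonneg _) (by positivity)
    _ = _ := by ring

lemma FI.mono {d : ℕ} {a b : ℤ} {f : Eu d → ℝ} (hf : FI d a f) (hab : a ≤ b) : FI d b f := by
  obtain ⟨C, hC, h⟩ := hf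
  refine ⟨C, hC, fun x hx => (h x hx).trans ?_⟩
  gcongr 1
  exact zpow_le_zpow_right₀ hx hab

lemma FI.const (d : ℕ) (c : ℝ) : FI d 0 (fun _ => c) := ⟨|c|, abs_nonneg c, by simp⟩

lemma FI.sum {d : ℕ} {a : ℤ} {ι : Type*} (s : Finset ι) {f : ι → Eu d → ℝ}
    (h : ∀ i ∈ s, FI d a (f i)) : FI d a (fun x => ∑ i ∈ s, f i x) := by
  classical
  induction s using Finset.induction_on with
  | empty => exact ⟨0, le_rfl, by simp⟩
  | insert i s hi ih =>
    simp only [Finset.sum_insert hi]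
    exact (h i (by simp)).add (ih fun j hj => h j (by simp [hj]))

lemma NZ.norm (d : ℕ) : NZ d 1 (fun x => ‖x‖) := ⟨1, zero_le_one, by simp⟩
lemma FI.norm (d : ℕ) : FI d 1 (fun x => ‖x‖) := ⟨1, zero_le_one, by simp⟩
lemma NZ.normsq (d : ℕ) : NZ d 2 (fun x => ‖x‖ ^ 2) := ⟨1, zero_le_one, by simp⟩
lemma FI.normsq (d : ℕ) : FI d 2 (fun x => ‖x‖ ^ 2) := by
  refine ⟨1, zero_le_one, fun x _ => ?_⟩
  rw [abs_of_nonneg (by positivity), one_mul]; norm_cast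
lemma NZ.coord {d : ℕ} (i : Fin d) : NZ d 1 (fun x => x i) :=
  ⟨1, zero_le_one, fun x _ => by simpa using abs_coord_le x i⟩
lemma FI.coord {d : ℕ} (i : Fin d) : FI d 1 (fun x => x i) :=
  ⟨1, zero_le_one, fun x _ => by simpa using abs_coord_le x i⟩
lemma NZ.TT {d : ℕ} (j : ℕ) (f : Eu d → ℝ) : NZ d j (TT d j f) := by
  obtain ⟨C, hC, h⟩ := TT_bound j f
  exact ⟨C, hC, fun x _ => h x⟩
lemma FI.TT {d : ℕ} (j : ℕ) (f : Eu d → ℝ) : FI d j (TT d j f) := by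
  obtain ⟨C, hC, h⟩ := TT_bound j f
  exact ⟨C, hC, fun x _ => by simpa using h x⟩

/-- integrability from orders -/
lemma integrable_of_ord {d j : ℕ} (hd : 0 < d) {f : Eu d → ℝ} (hm : Measurable f)
    (h1 : NZ d (j + 1) f) (h2 : FI d ((j:ℤ) - 1) f) {s : ℝ} (hs : s = -(d:ℝ) - j) :
    Integrable (fun x => ‖x‖ ^ s * f x) := by
  obtain ⟨C, hC, h⟩ := h1
  obtain ⟨D, hD, h'⟩ := h2
  refine integrable_of_wt hd (by fun_prop) (max C D) fun x hx => ?_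
  have hx0 : 0 < ‖x‖ := norm_pos_iff.2 hx
  have hp : ‖x‖ ^ s * ‖x‖ ^ j = ‖x‖ ^ (-(d:ℝ)) := by
    rw [← Real.rpow_natCast, ← Real.rpow_add hx0]; congr 1; rw [hs]; ring
  rw [abs_mul, abs_of_nonneg (by positivity)]
  unfold wt
  rw [← hp]
  rcases le_total ‖x‖ 1 with h1 | h1
  · rw [min_eq_left (h1.trans ((one_le_inv₀ hx0).2 h1))]
    calc _ ≤ ‖x‖ ^ s * (C * ‖x‖ ^ (j+1)) := by gcongr; exact h x h1
      _ = C * (‖x‖ ^ s * ‖x‖ ^ j * ‖x‖) := by ring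
      _ ≤ _ := by gcongr; exact le_max_left _ _
  · rw [min_eq_right ((inv_le_one_of_one_le₀ h1).trans h1)]
    calc _ ≤ ‖x‖ ^ s * (D * ‖x‖ ^ ((j:ℤ)-1)) := by gcongr; exact h' x h1
      _ = D * (‖x‖ ^ s * ‖x‖ ^ j * ‖x‖⁻¹) := by
        rw [zpow_sub_one₀ hx0.ne', zpow_natCast]; ring
      _ ≤ _ := by gcongr; exact le_max_right _ _

lemma Wt_of_ord {d k : ℕ} {f : Eu d → ℝ}
    (h1 : NZ d (2 * k + 3) f) (h2 : FI d (2 * (k:ℤ) + 1) f) :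
    ∃ C, 0 ≤ C ∧ ∀ x, |f x| ≤ C * Wt d k x := by
  obtain ⟨C, hC, h⟩ := h1
  obtain ⟨D, hD, h'⟩ := h2
  refine ⟨max C D, le_max_of_le_left hC, fun x => ?_⟩
  unfold Wt
  rcases le_total ‖x‖ 1 with h1 | h1
  · rcases eq_or_ne x 0 with rfl | hx
    · have := h 0 (by simp)
      simpa using this
    have hx0 : 0 < ‖x‖ := norm_pos_iff.2 hx
    rw [min_eq_left (h1.trans ((one_le_inv₀ hx0).2 h1))]
    calc _ ≤ C * ‖x‖ ^ (2*k+3) := h x h1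
      _ = C * (‖x‖ ^ (2*k+2) * ‖x‖) := by ring
      _ ≤ _ := by gcongr; exact le_max_left _ _
  · have hx0 : 0 < ‖x‖ := by linarith
    rw [min_eq_right ((inv_le_one_of_one_le₀ h1).trans h1)]
    calc _ ≤ D * ‖x‖ ^ (2 * (k:ℤ) + 1) := h' x h1
      _ = D * (‖x‖ ^ (2*k+2) * ‖x‖⁻¹) := by
        rw [show 2 * (k:ℤ) + 1 = ((2 * k + 2 : ℕ) : ℤ) - 1 by push_cast; ring,
          zpow_sub_one₀ hx0.ne', zpow_natCast]
      _ ≤ _ := by gcongr; exact le_max_right _ _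

/-- Taylor remainder -/
def RR (d j : ℕ) (f : Eu d → ℝ) : Eu d → ℝ := fun x => f x - ∑ i ∈ Finset.range j, TT d i f x

lemma RR_contDiff {d j : ℕ} {f : Eu d → ℝ} (hf : ContDiff ℝ ∞ f) : ContDiff ℝ ∞ (RR d j f) :=
  hf.sub (ContDiff.sum fun i _ => TT_contDiff d i f)

lemma Dd_RR {d j : ℕ} {f : Eu d → ℝ} (hf : ContDiff ℝ ∞ f) (i : Fin d) :
    Dd d i (RR d (j + 1) f) = RR d j (Dd d i f) := by
  unfold RR
  rw [Dd_sub i hf (ContDiff.sum fun i _ => TT_contDiff d i f),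
    Dd_sum _ _ fun a _ => TT_contDiff d a f]
  funext x
  simp only [Finset.sum_range_succ', Dd_TT _ hf, Dd_TT_zero, add_zero]

lemma lapl_RR {d j : ℕ} {f : Eu d → ℝ} (hf : ContDiff ℝ ∞ f) :
    lapl d (RR d (j + 2) f) = RR d j (lapl d f) := by
  rw [lapl_eq, lapl_eq]
  unfold RR
  simp only [TT_sum Finset.univ _ fun i _ => Dd_contDiff (i := i) (Dd_contDiff (i := i) hf)]
  funext x
  rw [Finset.sum_comm, ← Finset.sum_sub_distrib]
  refine Finset.sum_congr rfl fun i _ => ?_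
  exact congrFun (by rw [Dd_RR hf, Dd_RR (Dd_contDiff hf)] :
    Dd d i (Dd d i (RR d (j + 2) f)) = RR d j (Dd d i (Dd d i f))) x

lemma NZ.RR {d j : ℕ} {f : Eu d → ℝ} (hf : ContDiff ℝ ∞ f) : NZ d (j + 1) (RR d (j + 1) f) :=
  taylor_bound j hf

/-- being a Schwartz function -/
def IsSw (d : ℕ) (f : Eu d → ℝ) : Prop := ∃ ψ : SchwartzMap (Eu d) ℝ, f = ⇑ψ

lemma IsSw.contDiff {d : ℕ} {f : Eu d → ℝ} (h : IsSw d f) : ContDiff ℝ ∞ f := by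
  obtain ⟨ψ, rfl⟩ := h
  exact ψ.smooth ⊤

open LineDeriv in
lemma IsSw.Dd {d : ℕ} {f : Eu d → ℝ} (h : IsSw d f) (i : Fin d) : IsSw d (Dd d i f) := by
  obtain ⟨ψ, rfl⟩ := h
  exact ⟨∂_{(EuclideanSpace.single i 1 : Eu d)} ψ, rfl⟩

lemma IsSw.lapl {d : ℕ} {f : Eu d → ℝ} (h : IsSw d f) : IsSw d (lapl d f) := by
  choose g hg using fun i => (h.Dd i).Dd i
  refine ⟨∑ i, g i, ?_⟩
  rw [lapl_eq]
  funext x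
  simp [hg]

lemma FI.sw {d : ℕ} {f : Eu d → ℝ} (h : IsSw d f) (b : ℤ) : FI d b f := by
  obtain ⟨ψ, rfl⟩ := h
  obtain ⟨C, hC0, hC⟩ := ψ.decay b.natAbs 0
  refine ⟨C, hC0.le, fun x hx => ?_⟩
  have := hC x
  simp only [norm_iteratedFDeriv_zero, Real.norm_eq_abs] at this
  have hx0 : 0 < ‖x‖ := by linarith
  have e : (1:ℝ) ≤ ‖x‖ ^ b * ‖x‖ ^ b.natAbs := by
    rw [← zpow_natCast, ← zpow_add₀ hx0.ne']
    exact one_le_zpow₀ hx (by omega)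
  calc |ψ x| ≤ (‖x‖ ^ b * ‖x‖ ^ b.natAbs) * |ψ x| := le_mul_of_one_le_left (abs_nonneg _) e
    _ = ‖x‖ ^ b * (‖x‖ ^ b.natAbs * |ψ x|) := by ring
    _ ≤ ‖x‖ ^ b * C := by gcongr
    _ = _ := mul_comm _ _

lemma FI.RR {d j : ℕ} {f : Eu d → ℝ} (hf : IsSw d f) {b : ℤ} (hb : (j:ℤ) ≤ b + 1) :
    FI d b (RR d j f) := by
  refine (FI.sw hf b).sub (FI.sum _ fun i hi => (FI.TT i f).mono ?_)
  have := Finset.mem_range.1 hi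
  omega

end

section

open scoped ContDiff

/-- smooth cutoff profile -/
def pc (c r : ℝ) : ℝ := (1 + c * r ^ 2)⁻¹

def chi (d : ℕ) (c : ℝ) : Eu d → ℝ := fun x => pc c ‖x‖

lemma pc_pos {c : ℝ} (hc : 1 ≤ c) (r : ℝ) : 0 < pc c r := by unfold pc; positivity

lemma pc_mul {c : ℝ} (hc : 1 ≤ c) (r : ℝ) : pc c r * (1 + c * r ^ 2) = 1 := by
  unfold pc; exact inv_mul_cancel₀ (by positivity)

lemma pc_le_one {c : ℝ} (hc : 1 ≤ c) (r : ℝ) : pc c r ≤ 1 := by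
  unfold pc; exact inv_le_one_of_one_le₀ (by nlinarith [sq_nonneg r])

lemma pc_le_inv {c : ℝ} (hc : 1 ≤ c) (r : ℝ) : pc c r ≤ (1 + r ^ 2)⁻¹ := by
  unfold pc
  gcongr
  nlinarith [sq_nonneg r]

lemma sq_pc_le {c : ℝ} (hc : 1 ≤ c) (r : ℝ) : r ^ 2 * pc c r ≤ 1 := by
  have := pc_mul hc r
  nlinarith [pc_pos hc r, mul_nonneg (pc_pos hc r).le (sq_nonneg r)]

lemma chi_contDiff (d : ℕ) {c : ℝ} (hc : 1 ≤ c) : ContDiff ℝ ∞ (chi d c) := by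
  unfold chi pc
  refine ContDiff.inv ?_ fun x => by positivity
  exact contDiff_const.add (contDiff_const.mul (contDiff_norm_sq ℝ))

lemma Dd_normsq {d : ℕ} (i : Fin d) : Dd d i (fun x => ‖x‖ ^ 2) = fun x => 2 * x i := by
  funext x
  unfold Dd
  have h1 : HasFDerivAt (fun y : Eu d => ‖y‖ ^ 2) (2 • (innerSL ℝ x)) x :=
    (hasStrictFDerivAt_norm_sq x).hasFDerivAt
  rw [h1.fderiv]
  simp [EuclideanSpace.inner_single_right]

lemma Dd_chi {d : ℕ} {c : ℝ} (hc : 1 ≤ c) (i : Fin d) :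
    Dd d i (chi d c) = fun x => (-(2 * c)) * (x i * (chi d c x * chi d c x)) := by
  have hn : ContDiff ℝ ∞ (fun x : Eu d => ‖x‖ ^ 2) := contDiff_norm_sq ℝ
  have h1 : ContDiff ℝ ∞ (fun x : Eu d => 1 + c * ‖x‖ ^ 2) :=
    contDiff_const.add (contDiff_const.mul hn)
  have h2 : (fun x => chi d c x * (1 + c * ‖x‖ ^ 2)) = fun _ => 1 := by
    funext x; exact pc_mul hc _
  have h3 := Dd_mul i (chi_contDiff d hc) h1
  rw [h2, Dd_const, Dd_add i contDiff_const (contDiff_const.mul hn), Dd_const,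
    Dd_mul i contDiff_const hn, Dd_const, Dd_normsq] at h3
  funext x
  have h4 := congrFun h3 x
  have h5 : chi d c x * (1 + c * ‖x‖ ^ 2) = 1 := pc_mul hc _
  simp only at h4
  linear_combination (-(chi d c x)) * h4 - Dd d i (chi d c) x * h5

lemma Dd_Dd_chi {d : ℕ} {c : ℝ} (hc : 1 ≤ c) (i : Fin d) :
    Dd d i (Dd d i (chi d c)) = fun x => (-(2 * c)) * (chi d c x * chi d c x)
      + (8 * c ^ 2) * ((x i * x i) * (chi d c x * chi d c x * chi d c x)) := by
  have h0 := chi_contDiff d hc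
  rw [Dd_chi hc, Dd_mul i contDiff_const ((contDiff_coord i).mul (h0.mul h0)),
    Dd_mul i (contDiff_coord i) (h0.mul h0), Dd_mul i h0 h0, Dd_const, Dd_coord, Dd_chi hc]
  funext x
  simp only [if_true]
  ring

lemma NZ.chi (d : ℕ) {c : ℝ} (hc : 1 ≤ c) : NZ d 0 (chi d c) :=
  ⟨1, zero_le_one, fun x _ => by
    have := pc_pos hc ‖x‖
    have := pc_le_one hc ‖x‖
    unfold _root_.chi
    rw [abs_of_pos (by assumption)]; simpa⟩

lemma FI.chi (d : ℕ) {c : ℝ} (hc : 1 ≤ c) : FI d (-2) (chi d c) :=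
  ⟨1, zero_le_one, fun x hx => by
    have h1 := pc_pos hc ‖x‖
    have h2 := sq_pc_le hc ‖x‖
    unfold _root_.chi
    rw [abs_of_pos h1, one_mul, zpow_neg, ← one_div, le_div_iff₀ (by positivity), mul_comm]
    exact_mod_cast h2⟩

lemma NZ.one_sub_chi (d : ℕ) {c : ℝ} (hc : 1 ≤ c) : NZ d 2 (fun x => 1 - _root_.chi d c x) := by
  have h : (fun x => 1 - _root_.chi d c x) = fun x => ‖x‖ ^ 2 * (c * _root_.chi d c x) := by
    funext x
    have : _root_.chi d c x * (1 + c * ‖x‖ ^ 2) = 1 := pc_mul hc _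
    linear_combination -this
  rw [h]
  exact (NZ.normsq d).mul ((NZ.const d c).mul (NZ.chi d hc))

lemma NZ.Dchi {d : ℕ} {c : ℝ} (hc : 1 ≤ c) (i : Fin d) : NZ d 1 (Dd d i (_root_.chi d c)) := by
  rw [Dd_chi hc]
  exact ((NZ.const d _).mul ((NZ.coord i).mul ((NZ.chi d hc).mul (NZ.chi d hc)))).mono (by norm_num)

lemma FI.Dchi {d : ℕ} {c : ℝ} (hc : 1 ≤ c) (i : Fin d) : FI d (-3) (Dd d i (_root_.chi d c)) := by
  rw [Dd_chi hc]
  exact ((FI.const d _).mul ((FI.coord i).mul ((FI.chi d hc).mul (FI.chi d hc)))).mono (by norm_num)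

lemma NZ.DDchi {d : ℕ} {c : ℝ} (hc : 1 ≤ c) (i : Fin d) :
    NZ d 0 (Dd d i (Dd d i (_root_.chi d c))) := by
  rw [Dd_Dd_chi hc]
  have h := NZ.chi d hc
  exact ((NZ.const d _).mul (h.mul h)).add
    (((NZ.const d _).mul (((NZ.coord i).mul (NZ.coord i)).mul ((h.mul h).mul h))).mono (by norm_num))

lemma FI.DDchi {d : ℕ} {c : ℝ} (hc : 1 ≤ c) (i : Fin d) :
    FI d (-4) (Dd d i (Dd d i (_root_.chi d c))) := by
  rw [Dd_Dd_chi hc]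
  have h := FI.chi d hc
  exact (((FI.const d _).mul (h.mul h)).mono (by norm_num)).add
    (((FI.const d _).mul (((FI.coord i).mul (FI.coord i)).mul ((h.mul h).mul h))).mono (by norm_num))

lemma RR_succ {d j : ℕ} (f : Eu d → ℝ) (x : Eu d) : RR d j f x = RR d (j + 1) f x + TT d j f x := by
  unfold RR
  rw [Finset.sum_range_succ]; ring

/-- the regularised function -/
def GG (d k : ℕ) (c : ℝ) (f : Eu d → ℝ) : Eu d → ℝ :=
  fun x => RR d (2 * k + 2) f x - chi d c x * TT d (2 * k + 2) f x

lemma GG_contDiff {d k : ℕ} {c : ℝ} (hc : 1 ≤ c) {f : Eu d → ℝ} (hf : ContDiff ℝ ∞ f) :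
    ContDiff ℝ ∞ (GG d k c f) :=
  (RR_contDiff hf).sub ((chi_contDiff d hc).mul (TT_contDiff _ _ _))

lemma Dd_GG {d k : ℕ} {c : ℝ} (hc : 1 ≤ c) {f : Eu d → ℝ} (hf : ContDiff ℝ ∞ f) (i : Fin d) :
    Dd d i (GG d k c f) = fun x => RR d (2 * k + 1) (Dd d i f) x
      - (chi d c x * TT d (2 * k + 1) (Dd d i f) x + Dd d i (chi d c) x * TT d (2 * k + 2) f x) := by
  have h0 := chi_contDiff d hc
  unfold GG
  rw [Dd_sub i (RR_contDiff hf) (h0.mul (TT_contDiff _ _ _)), Dd_mul i h0 (TT_contDiff _ _ _),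
    show Dd d i (fun x => RR d (2 * k + 2) f x) = RR d (2 * k + 1) (Dd d i f) from Dd_RR hf i,
    Dd_TT (2 * k + 1) hf i]

lemma Dd_Dd_GG {d k : ℕ} {c : ℝ} (hc : 1 ≤ c) {f : Eu d → ℝ} (hf : ContDiff ℝ ∞ f) (i : Fin d) :
    Dd d i (Dd d i (GG d k c f)) = fun x => RR d (2 * k) (Dd d i (Dd d i f)) x
      - (chi d c x * TT d (2 * k) (Dd d i (Dd d i f)) x
        + 2 * (Dd d i (chi d c) x * TT d (2 * k + 1) (Dd d i f) x)
        + Dd d i (Dd d i (chi d c)) x * TT d (2 * k + 2) f x) := by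
  have h0 := chi_contDiff d hc
  have h1 : ContDiff ℝ ∞ (Dd d i (chi d c)) := Dd_contDiff h0
  have hf1 : ContDiff ℝ ∞ (Dd d i f) := Dd_contDiff hf
  rw [Dd_GG hc hf]
  rw [Dd_sub i (RR_contDiff hf1) ((h0.mul (TT_contDiff _ _ _)).add (h1.mul (TT_contDiff _ _ _))),
    Dd_add i (h0.mul (TT_contDiff _ _ _)) (h1.mul (TT_contDiff _ _ _)),
    Dd_mul i h0 (TT_contDiff _ _ _), Dd_mul i h1 (TT_contDiff _ _ _),
    show Dd d i (fun x => RR d (2 * k + 1) (Dd d i f) x) = RR d (2 * k) (Dd d i (Dd d i f))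
      from Dd_RR hf1 i,
    Dd_TT (2 * k + 1) hf i, Dd_TT (2 * k) hf1 i]
  funext x
  ring

lemma GG_bound0 {d k : ℕ} {c : ℝ} (hc : 1 ≤ c) {f : Eu d → ℝ} (hf : IsSw d f) :
    ∃ C, 0 ≤ C ∧ ∀ x, |GG d k c f x| ≤ C * Wt d k x := by
  refine Wt_of_ord ?_ ?_
  · have e : GG d k c f = fun x => RR d (2 * k + 2 + 1) f x
        + (1 - chi d c x) * TT d (2 * k + 2) f x := by
      funext x; unfold GG; rw [RR_succ]; ring
    rw [e]
    exact (NZ.RR hf.contDiff).add (((NZ.one_sub_chi d hc).mul (NZ.TT _ f)).mono (by omega))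
  · exact (FI.RR hf (by push_cast; omega)).sub
      (((FI.chi d hc).mul (FI.TT (2 * k + 2) f)).mono (by push_cast; omega))

lemma GG_bound1 {d k : ℕ} {c : ℝ} (hc : 1 ≤ c) {f : Eu d → ℝ} (hf : IsSw d f) (i : Fin d) :
    ∃ C, 0 ≤ C ∧ ∀ x, ‖x‖ * |Dd d i (GG d k c f) x| ≤ C * Wt d k x := by
  have : ∃ C, 0 ≤ C ∧ ∀ x, |‖x‖ * Dd d i (GG d k c f) x| ≤ C * Wt d k x := by
    rw [Dd_GG hc hf.contDiff]
    refine Wt_of_ord ?_ ?_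
    · have e : (fun x => ‖x‖ * (RR d (2 * k + 1) (Dd d i f) x
          - (chi d c x * TT d (2 * k + 1) (Dd d i f) x + Dd d i (chi d c) x * TT d (2 * k + 2) f x)))
          = fun x => ‖x‖ * (RR d (2 * k + 1 + 1) (Dd d i f) x
          + ((1 - chi d c x) * TT d (2 * k + 1) (Dd d i f) x
            - Dd d i (chi d c) x * TT d (2 * k + 2) f x)) := by
        funext x; rw [RR_succ (j := 2 * k + 1)]; ring
      rw [e]
      refine ((NZ.norm d).mul ((NZ.RR (hf.Dd i).contDiff).add
        (NZ.sub (a := 2 * k + 2) ?_ ?_))).mono (by omega)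
      · exact ((NZ.one_sub_chi d hc).mul (NZ.TT _ _)).mono (by omega)
      · exact ((NZ.Dchi hc i).mul (NZ.TT _ _)).mono (by omega)
    · refine ((FI.norm d).mul (FI.sub (a := 2 * k) (FI.RR (hf.Dd i) (by push_cast; omega))
        (FI.add ?_ ?_))).mono (by omega)
      · exact ((FI.chi d hc).mul (FI.TT _ _)).mono (by push_cast; omega)
      · exact ((FI.Dchi hc i).mul (FI.TT _ _)).mono (by push_cast; omega)
  simpa only [abs_mul, abs_norm] using this

lemma GG_bound2 {d k : ℕ} {c : ℝ} (hc : 1 ≤ c) {f : Eu d → ℝ} (hf : IsSw d f) (i : Fin d) :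
    ∃ C, 0 ≤ C ∧ ∀ x, ‖x‖ ^ 2 * |Dd d i (Dd d i (GG d k c f)) x| ≤ C * Wt d k x := by
  have : ∃ C, 0 ≤ C ∧ ∀ x, |‖x‖ ^ 2 * Dd d i (Dd d i (GG d k c f)) x| ≤ C * Wt d k x := by
    rw [Dd_Dd_GG hc hf.contDiff]
    refine Wt_of_ord ?_ ?_
    · have e : (fun x => ‖x‖ ^ 2 * (RR d (2 * k) (Dd d i (Dd d i f)) x
          - (chi d c x * TT d (2 * k) (Dd d i (Dd d i f)) x
            + 2 * (Dd d i (chi d c) x * TT d (2 * k + 1) (Dd d i f) x)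
            + Dd d i (Dd d i (chi d c)) x * TT d (2 * k + 2) f x)))
          = fun x => ‖x‖ ^ 2 * (RR d (2 * k + 1) (Dd d i (Dd d i f)) x
          + ((1 - chi d c x) * TT d (2 * k) (Dd d i (Dd d i f)) x
            - 2 * (Dd d i (chi d c) x * TT d (2 * k + 1) (Dd d i f) x)
            - Dd d i (Dd d i (chi d c)) x * TT d (2 * k + 2) f x)) := by
        funext x; rw [RR_succ (j := 2 * k)]; ring
      rw [e]
      refine ((NZ.normsq d).mul ((NZ.RR ((hf.Dd i).Dd i).contDiff).add
        (NZ.sub (a := 2 * k + 1) (NZ.sub ?_ ?_) ?_))).mono (by omega)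
      · exact ((NZ.one_sub_chi d hc).mul (NZ.TT _ _)).mono (by omega)
      · exact ((NZ.const d 2).mul ((NZ.Dchi hc i).mul (NZ.TT _ _))).mono (by omega)
      · exact ((NZ.DDchi hc i).mul (NZ.TT _ _)).mono (by omega)
    · refine ((FI.normsq d).mul (FI.sub (a := 2 * k - 1)
        (FI.RR ((hf.Dd i).Dd i) (by push_cast; omega))
        (FI.add (FI.add ?_ ?_) ?_))).mono (by omega)
      · exact ((FI.chi d hc).mul (FI.TT _ _)).mono (by push_cast; omega)
      · exact ((FI.const d 2).mul ((FI.Dchi hc i).mul (FI.TT _ _))).mono (by push_cast; omega)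
      · exact ((FI.DDchi hc i).mul (FI.TT _ _)).mono (by push_cast; omega)
  simpa only [abs_mul, abs_pow, abs_norm] using this

lemma GG_ibp {d k : ℕ} (hd : 3 ≤ d) {c : ℝ} (hc : 1 ≤ c) {f : Eu d → ℝ} (hf : IsSw d f) :
    Integrable (fun x => ‖x‖ ^ (-(d:ℝ) - 2 * k) * lapl d (GG d k c f) x) ∧
    Integrable (fun x => ‖x‖ ^ (-(d:ℝ) - 2 * k - 2) * GG d k c f x) ∧
    ∫ x, ‖x‖ ^ (-(d:ℝ) - 2 * k) * lapl d (GG d k c f) x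
      = (d + 2 * k) * (2 * k + 2) * ∫ x, ‖x‖ ^ (-(d:ℝ) - 2 * k - 2) * GG d k c f x := by
  obtain ⟨C0, p0, h0⟩ := GG_bound0 (k := k) hc hf
  choose C1 p1 h1 using GG_bound1 (k := k) hc hf
  choose C2 p2 h2 using GG_bound2 (k := k) hc hf
  have q1 : ∀ i, C1 i ≤ ∑ i, C1 i := fun i =>
    Finset.single_le_sum (fun j _ => p1 j) (Finset.mem_univ i)
  have q2 : ∀ i, C2 i ≤ ∑ i, C2 i := fun i =>
    Finset.single_le_sum (fun j _ => p2 j) (Finset.mem_univ i)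
  have r1 : 0 ≤ ∑ i, C1 i := Finset.sum_nonneg fun j _ => p1 j
  have r2 : 0 ≤ ∑ i, C2 i := Finset.sum_nonneg fun j _ => p2 j
  refine ibp hd (GG_contDiff hc hf.contDiff) (C0 + ∑ i, C1 i + ∑ i, C2 i) ?_ ?_ ?_
  · intro x
    exact (h0 x).trans (mul_le_mul_of_nonneg_right (by linarith) (Wt_nonneg d k x))
  · intro i x
    exact (h1 i x).trans (mul_le_mul_of_nonneg_right (by linarith [q1 i]) (Wt_nonneg d k x))
  · intro i x
    exact (h2 i x).trans (mul_le_mul_of_nonneg_right (by linarith [q2 i]) (Wt_nonneg d k x))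

/-- radial error weight -/
def ww (d k : ℕ) (c r : ℝ) : ℝ :=
  (-(4 * c * (2 * k + 2) + 2 * c * d)) * (pc c r * pc c r)
    + (8 * c ^ 2) * (r ^ 2 * (pc c r * pc c r * pc c r))

lemma lapl_GG {d k : ℕ} {c : ℝ} (hc : 1 ≤ c) {f : Eu d → ℝ} (hf : ContDiff ℝ ∞ f) (x : Eu d) :
    lapl d (GG d k c f) x = RR d (2 * k) (lapl d f) x
      - chi d c x * TT d (2 * k) (lapl d f) x - ww d k c ‖x‖ * TT d (2 * k + 2) f x := by
  have hn : ∑ i, x i * x i = ‖x‖ ^ 2 := by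
    rw [EuclideanSpace.norm_sq_eq]; simp [sq]
  have e1 := TT_succ (2 * k + 1) hf x
  have hl : RR d (2 * k) (lapl d f) x = ∑ i, RR d (2 * k) (Dd d i (Dd d i f)) x := by
    unfold RR
    rw [Finset.sum_sub_distrib, Finset.sum_comm]
    rw [lapl_eq]
    simp only [TT_sum Finset.univ _ fun i _ => Dd_contDiff (i := i) (Dd_contDiff (i := i) hf)]
  have hq : TT d (2 * k) (lapl d f) x = ∑ i, TT d (2 * k) (Dd d i (Dd d i f)) x := by
    rw [lapl_eq]
    simp only [TT_sum Finset.univ _ fun i _ => Dd_contDiff (i := i) (Dd_contDiff (i := i) hf)]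
  rw [lapl_eq]
  simp only [Dd_Dd_GG hc hf, Dd_Dd_chi hc]
  simp only [Dd_chi hc]
  rw [Finset.sum_sub_distrib, Finset.sum_add_distrib, Finset.sum_add_distrib, ← hl, ← Finset.mul_sum,
    ← hq]
  have e2 : ∑ i, 2 * (-(2 * c) * (x i * (chi d c x * chi d c x)) * TT d (2 * k + 1) (Dd d i f) x)
      = -(4 * c * (2 * k + 2)) * (chi d c x * chi d c x) * TT d (2 * k + 2) f x := by
    have : ∀ i, 2 * (-(2 * c) * (x i * (chi d c x * chi d c x)) * TT d (2 * k + 1) (Dd d i f) x)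
      = (-(4 * c) * (chi d c x * chi d c x)) * (x i * TT d (2 * k + 1) (Dd d i f) x) := by
      intro i; ring
    simp only [this]
    rw [← Finset.mul_sum, ← e1]
    push_cast
    ring
  rw [e2, ← Finset.sum_mul, Finset.sum_add_distrib, ← Finset.mul_sum (Finset.univ) (fun i => x i * x i * _),
    ← Finset.sum_mul, ← Finset.sum_mul, hn]
  simp only [Finset.sum_const, Finset.card_univ, Fintype.card_fin, nsmul_eq_mul]
  unfold ww chi
  ring

end

section

open scoped ContDiff

/-- step function -/
def th (l r : ℝ) : ℝ := if r ≤ l then 1 else 0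

lemma th_meas (l : ℝ) : Measurable (th l) := by
  unfold th
  exact Measurable.ite measurableSet_Iic measurable_const measurable_const

lemma pc_meas (c : ℝ) : Measurable (pc c) := by
  unfold pc; fun_prop

lemma subExt_eq (d k : ℕ) (l : ℝ) (f : Eu d → ℝ) : subExt d k l f
    = ∫ x, ‖x‖ ^ (-(d:ℝ) - 2 * k) * (RR d (2 * k) f x - th l ‖x‖ * TT d (2 * k) f x) := by
  unfold subExt RR TT th
  congr 1
  funext x
  rw [mul_assoc (if ‖x‖ ≤ l then (1:ℝ) else 0)]

lemma NZ.cut {d : ℕ} {c l : ℝ} (hc : 1 ≤ c) (hl : 0 < l) :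
    NZ d 2 (fun x => _root_.chi d c x - th l ‖x‖) := by
  obtain ⟨C, hC, h⟩ := NZ.one_sub_chi d hc
  refine ⟨C + (l ^ 2)⁻¹, by positivity, fun x hx => ?_⟩
  simp only [th]
  split_ifs with h1
  · rw [abs_sub_comm]
    refine (h x hx).trans ?_
    gcongr
    have : 0 < (l ^ 2)⁻¹ := by positivity
    linarith
  · rw [sub_zero]
    push Not at h1
    have h2 : |_root_.chi d c x| ≤ 1 := by
      unfold _root_.chi
      rw [abs_of_pos (pc_pos hc _)]; exact pc_le_one hc _
    refine h2.trans ?_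
    have h3 : 1 ≤ (l ^ 2)⁻¹ * ‖x‖ ^ 2 := by
      rw [inv_mul_eq_div, one_le_div (by positivity)]
      gcongr
    nlinarith [mul_nonneg hC (sq_nonneg ‖x‖)]

lemma FI.cut {d : ℕ} {c l : ℝ} (hc : 1 ≤ c) (hl : 0 < l) :
    FI d (-2) (fun x => _root_.chi d c x - th l ‖x‖) := by
  refine (FI.chi d hc).sub ⟨l ^ 2, by positivity, fun x hx => ?_⟩
  have hx0 : 0 < ‖x‖ := by linarith
  show |if ‖x‖ ≤ l then (1:ℝ) else 0| ≤ _
  split_ifs with h1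
  · rw [abs_one, zpow_neg, ← div_eq_mul_inv, one_le_div (by positivity)]
    have : ‖x‖ ^ 2 ≤ l ^ 2 := by gcongr
    exact_mod_cast this
  · rw [abs_zero]; positivity

lemma NZ.ww {d k : ℕ} {c : ℝ} (hc : 1 ≤ c) : NZ d 0 (fun x => ww d k c ‖x‖) := by
  have h := NZ.chi d hc
  exact ((NZ.const d _).mul (h.mul h)).add
    (((NZ.const d _).mul ((NZ.normsq d).mul ((h.mul h).mul h))).mono (by norm_num))

lemma FI.ww {d k : ℕ} {c : ℝ} (hc : 1 ≤ c) : FI d (-4) (fun x => ww d k c ‖x‖) := by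
  have h := FI.chi d hc
  exact (((FI.const d _).mul (h.mul h)).mono (by norm_num)).add
    (((FI.const d _).mul ((FI.normsq d).mul ((h.mul h).mul h))).mono (by norm_num))

lemma ww_meas (d k : ℕ) (c : ℝ) : Measurable (ww d k c) := by
  have := pc_meas c
  unfold ww; fun_prop

open Set Filter Topology

/-- the logarithmic integral -/
def Ic (c l : ℝ) : ℝ := ∫ r in Ioi (0:ℝ), r⁻¹ * (pc c r - th l r)

lemma Ic_int {c l : ℝ} (hc : 1 ≤ c) (hl : 0 < l) :
    IntegrableOn (fun r => r⁻¹ * (pc c r - th l r)) (Ioi 0) := by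
  have hm : Measurable (fun r => r⁻¹ * (pc c r - th l r)) := by
    have := pc_meas c
    have := th_meas l
    fun_prop
  refine ((integrable_inv_one_add_sq.const_mul (c * l + l⁻¹)).integrableOn).mono'
    hm.aestronglyMeasurable ?_
  refine (ae_restrict_iff' measurableSet_Ioi).2 (.of_forall fun r hr => ?_)
  have hr : 0 < r := hr
  have hp := pc_pos hc r
  have hle := pc_le_inv hc r
  have hb : |r⁻¹ * (pc c r - th l r)| ≤ (c * l + l⁻¹) * pc c r := by
    unfold th
    split_ifs with h
    · have e : r⁻¹ * (pc c r - 1) = -(c * r * pc c r) := by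
        have := pc_mul hc r
        field_simp
        linear_combination this
      rw [e, abs_neg, abs_of_nonneg (by positivity)]
      gcongr
      have : c * r ≤ c * l := by gcongr
      have : 0 < l⁻¹ := by positivity
      linarith
    · push Not at h
      rw [sub_zero, abs_of_nonneg (by positivity)]
      gcongr
      have : r⁻¹ ≤ l⁻¹ := by gcongr
      have : 0 ≤ c * l := by positivity
      linarith
  exact hb.trans (mul_le_mul_of_nonneg_left hle (by positivity))

lemma Ic_diff {l : ℝ} (hl : 0 < l) : Ic 1 l ≠ Ic 2 l := by
  intro h
  have h1 := Ic_int (c := 1) le_rfl hl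
  have h2 := Ic_int (c := 2) (by norm_num) hl
  have h3 : ∫ r in Ioi (0:ℝ), (r⁻¹ * (pc 1 r - th l r) - r⁻¹ * (pc 2 r - th l r)) = 0 := by
    rw [integral_sub h1 h2]
    unfold Ic at h
    linarith
  have e : ∀ r ∈ Ioi (0:ℝ), 0 < r⁻¹ * (pc 1 r - th l r) - r⁻¹ * (pc 2 r - th l r) := by
    intro r hr
    have hr : 0 < r := hr
    rw [← mul_sub]
    have : pc 2 r < pc 1 r := by
      unfold pc
      gcongr
      norm_num
    have h5 : 0 < r⁻¹ := by positivity
    exact mul_pos h5 (by linarith)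
  have h4 := (setIntegral_pos_iff_support_of_nonneg_ae
    ((ae_restrict_iff' measurableSet_Ioi).2 (.of_forall fun r hr => (e r hr).le)) (h1.sub h2)).2 ?_
  · exact absurd h3 h4.ne'
  · have : Ioi (0:ℝ) ⊆ Function.support
        ((fun r => r⁻¹ * (pc 1 r - th l r)) - fun r => r⁻¹ * (pc 2 r - th l r)) ∩ Ioi 0 :=
      fun r hr => ⟨(e r hr).ne', hr⟩
    exact lt_of_lt_of_le (by simp) (measure_mono this)

lemma ww_integral {d k : ℕ} {c : ℝ} (hc : 1 ≤ c) :
    ∫ r in Ioi (0:ℝ), r * ww d k c r = -(4 * k + 2 + d) := by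
  have hder : ∀ r : ℝ, HasDerivAt (fun r => (4 * k + 2 + d) * pc c r - 2 * c * (r ^ 2 * (pc c r) ^ 2))
      (r * ww d k c r) r := by
    intro r
    have hp : HasDerivAt (pc c) (-(2 * c * r * (pc c r) ^ 2)) r := by
      have h1 : HasDerivAt (fun r : ℝ => 1 + c * r ^ 2) (c * (2 * r)) r := by
        simpa using ((hasDerivAt_pow 2 r).const_mul c).const_add 1
      have h2 := h1.inv (by positivity)
      refine h2.congr_deriv ?_
      unfold pc
      have : 1 + c * r ^ 2 ≠ 0 := by positivity
      field_simp
    have h3 := (hp.const_mul (4 * k + 2 + d : ℝ)).sub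
      (((hasDerivAt_pow 2 r).mul (hp.pow 2)).const_mul (2 * c))
    refine h3.congr_deriv ?_
    unfold ww
    simp
    ring
  have hInt : IntegrableOn (fun r => r * ww d k c r) (Ioi 0) := by
    have hm : Measurable (fun r => r * ww d k c r) := by
      have := ww_meas d k c
      fun_prop
    refine ((integrable_inv_one_add_sq.const_mul
      ((4 * c * (2 * k + 2) + 2 * c * d) + 8 * c ^ 2)).integrableOn).mono'
      hm.aestronglyMeasurable ?_
    refine (ae_restrict_iff' measurableSet_Ioi).2 (.of_forall fun r hr => ?_)
    have hr : 0 < r := hr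
    have hp := pc_pos hc r
    have hle := pc_le_inv hc r
    have h2 := sq_pc_le hc r
    have h1 := pc_le_one hc r
    have hrp : r * pc c r ≤ 1 := by nlinarith [sq_nonneg (r - 1)]
    set K : ℝ := 4 * c * (2 * k + 2) + 2 * c * d with hK
    have hK0 : 0 ≤ K := by positivity
    have e : r * ww d k c r = -(K * (r * pc c r) * pc c r)
        + 8 * c ^ 2 * ((r * pc c r) * (r ^ 2 * pc c r)) * pc c r := by
      unfold ww; ring
    rw [e, Real.norm_eq_abs]
    have hb1 : K * (r * pc c r) * pc c r ≤ K * pc c r := by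
      have := mul_le_mul_of_nonneg_left hrp hK0
      gcongr; linarith
    have hb2 : 8 * c ^ 2 * ((r * pc c r) * (r ^ 2 * pc c r)) * pc c r ≤ 8 * c ^ 2 * pc c r := by
      have : (r * pc c r) * (r ^ 2 * pc c r) ≤ 1 := mul_le_one₀ hrp (by positivity) h2
      have h8 : 8 * c ^ 2 * ((r * pc c r) * (r ^ 2 * pc c r)) ≤ 8 * c ^ 2 * 1 := by gcongr
      rw [mul_one] at h8
      exact mul_le_mul_of_nonneg_right h8 hp.le
    have hb3 : 0 ≤ K * (r * pc c r) * pc c r := by positivity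
    have hb4 : 0 ≤ 8 * c ^ 2 * ((r * pc c r) * (r ^ 2 * pc c r)) * pc c r := by positivity
    have hb5 : (K + 8 * c ^ 2) * pc c r ≤ (K + 8 * c ^ 2) * (1 + r ^ 2)⁻¹ := by gcongr
    rw [abs_le]
    constructor <;> nlinarith
  have h0 : Tendsto (fun r : ℝ => (1 + r ^ 2)⁻¹) atTop (𝓝 0) := by
    apply Tendsto.inv_tendsto_atTop
    exact tendsto_atTop_add_const_left _ _ (tendsto_pow_atTop (by norm_num))
  have hp0 : Tendsto (pc c) atTop (𝓝 0) :=
    squeeze_zero (fun r => (pc_pos hc r).le) (fun r => pc_le_inv hc r) h0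
  have hp1 : Tendsto (fun r => r ^ 2 * (pc c r) ^ 2) atTop (𝓝 0) := by
    refine squeeze_zero (fun r => by positivity) (fun r => ?_) hp0
    have := mul_le_mul_of_nonneg_right (sq_pc_le hc r) (pc_pos hc r).le
    nlinarith
  have ht := (hp0.const_mul (4 * k + 2 + d : ℝ)).sub (hp1.const_mul (2 * c))
  have := integral_Ioi_of_hasDerivAt_of_tendsto (a := 0)
    (hder 0).continuousAt.continuousWithinAt (fun r _ => hder r) hInt ht
  rw [this]
  simp [pc]

/-- spherical mean of the Taylor term -/
def SS (d j : ℕ) (f : Eu d → ℝ) : ℝ := ∫ w, TT d j f w.1 ∂(volume : Measure (Eu d)).toSphere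

lemma rpow_aux {d j : ℕ} (hd : 0 < d) {r s : ℝ} (hr : 0 < r) (hs : s = -(d:ℝ) - j) :
    r ^ (d - 1) * r ^ s * r ^ j = r⁻¹ := by
  rw [← Real.rpow_natCast, ← Real.rpow_natCast, ← Real.rpow_add hr, ← Real.rpow_add hr,
    ← Real.rpow_neg_one]
  congr 1
  rw [hs, Nat.cast_sub (by omega)]
  push_cast
  ring

lemma step_c {d k : ℕ} (hd : 3 ≤ d) {c l : ℝ} (hc : 1 ≤ c) (hl : 0 < l) {f : Eu d → ℝ}
    (hf : IsSw d f) :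
    subExt d k l (lapl d f) = (d + 2 * k) * (2 * k + 2) * subExt d (k + 1) l f
      + (SS d (2 * k) (lapl d f) - (d + 2 * k) * (2 * k + 2) * SS d (2 * k + 2) f) * Ic c l
      - (4 * k + 2 + d) * SS d (2 * k + 2) f := by
  have hd0 : 0 < d := by omega
  obtain ⟨i1, i2, e12⟩ := GG_ibp (k := k) hd hc hf
  have mQ : Measurable (TT d (2 * k) (lapl d f)) := (TT_contDiff _ _ _).continuous.measurable
  have mh : Measurable (TT d (2 * k + 2) f) := (TT_contDiff _ _ _).continuous.measurable
  have mc := pc_meas c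
  have mt := th_meas l
  have mw := ww_meas d k c
  have mcut : Measurable (fun x : Eu d => chi d c x - th l ‖x‖) := by
    unfold chi; fun_prop
  have hs1 : -(d:ℝ) - 2 * k = -(d:ℝ) - ((2 * k : ℕ) : ℝ) := by push_cast; ring
  have hs2 : -(d:ℝ) - 2 * k - 2 = -(d:ℝ) - ((2 * k + 2 : ℕ) : ℝ) := by push_cast; ring
  have j1 : Integrable (fun x : Eu d => ‖x‖ ^ (-(d:ℝ) - 2 * k) *
      ((chi d c x - th l ‖x‖) * TT d (2 * k) (lapl d f) x)) :=
    integrable_of_ord hd0 (mcut.mul mQ)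
      (((NZ.cut hc hl).mul (NZ.TT (2 * k) _)).mono (by omega))
      (((FI.cut hc hl).mul (FI.TT (2 * k) _)).mono (by push_cast; omega)) hs1
  have j2 : Integrable (fun x : Eu d => ‖x‖ ^ (-(d:ℝ) - 2 * k - 2) *
      ((chi d c x - th l ‖x‖) * TT d (2 * k + 2) f x)) :=
    integrable_of_ord hd0 (mcut.mul mh)
      (((NZ.cut hc hl).mul (NZ.TT (2 * k + 2) _)).mono (by omega))
      (((FI.cut hc hl).mul (FI.TT (2 * k + 2) _)).mono (by push_cast; omega)) hs2
  have j3 : Integrable (fun x : Eu d => ‖x‖ ^ (-(d:ℝ) - 2 * k) *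
      (ww d k c ‖x‖ * TT d (2 * k + 2) f x)) :=
    integrable_of_ord hd0 ((mw.comp measurable_norm).mul mh)
      (((NZ.ww hc).mul (NZ.TT (2 * k + 2) _)).mono (by omega))
      (((FI.ww hc).mul (FI.TT (2 * k + 2) _)).mono (by push_cast; omega)) hs1
  have v1 : ∫ x : Eu d, ‖x‖ ^ (-(d:ℝ) - 2 * k) *
      ((chi d c x - th l ‖x‖) * TT d (2 * k) (lapl d f) x) = SS d (2 * k) (lapl d f) * Ic c l := by
    have := polar_int hd0 (fun r => r ^ (-(d:ℝ) - 2 * k) * (pc c r - th l r))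
      (TT d (2 * k) (lapl d f)) (2 * k) (fun a x => TT_smul _ _ a x)
    simp only [mul_assoc] at this
    unfold chi
    rw [this]
    unfold SS Ic
    congr 1
    refine setIntegral_congr_fun measurableSet_Ioi fun r hr => ?_
    rw [← rpow_aux hd0 (show 0 < r from hr) hs1]
    ring
  have v2 : ∫ x : Eu d, ‖x‖ ^ (-(d:ℝ) - 2 * k - 2) *
      ((chi d c x - th l ‖x‖) * TT d (2 * k + 2) f x) = SS d (2 * k + 2) f * Ic c l := by
    have := polar_int hd0 (fun r => r ^ (-(d:ℝ) - 2 * k - 2) * (pc c r - th l r))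
      (TT d (2 * k + 2) f) (2 * k + 2) (fun a x => TT_smul _ _ a x)
    simp only [mul_assoc] at this
    unfold chi
    rw [this]
    unfold SS Ic
    congr 1
    refine setIntegral_congr_fun measurableSet_Ioi fun r hr => ?_
    rw [← rpow_aux hd0 (show 0 < r from hr) hs2]
    ring
  have v3 : ∫ x : Eu d, ‖x‖ ^ (-(d:ℝ) - 2 * k) *
      (ww d k c ‖x‖ * TT d (2 * k + 2) f x) = SS d (2 * k + 2) f * (-(4 * k + 2 + d)) := by
    have := polar_int hd0 (fun r => r ^ (-(d:ℝ) - 2 * k) * ww d k c r)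
      (TT d (2 * k + 2) f) (2 * k + 2) (fun a x => TT_smul _ _ a x)
    simp only [mul_assoc] at this
    rw [this, ← ww_integral (d := d) (k := k) hc]
    unfold SS
    congr 1
    refine setIntegral_congr_fun measurableSet_Ioi fun r hr => ?_
    have hr : 0 < r := hr
    have h := rpow_aux hd0 hr hs1
    have h5 : r ^ 2 * r⁻¹ = r := by field_simp
    calc _ = (r ^ (d - 1) * r ^ (-(d:ℝ) - 2 * k) * r ^ (2 * k)) * r ^ 2 * ww d k c r := by ring
      _ = (r ^ 2 * r⁻¹) * ww d k c r := by rw [h]; ring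
      _ = _ := by rw [h5]
  have l1 : subExt d k l (lapl d f) = (∫ x, ‖x‖ ^ (-(d:ℝ) - 2 * k) * lapl d (GG d k c f) x)
      + (SS d (2 * k) (lapl d f) * Ic c l + SS d (2 * k + 2) f * (-(4 * k + 2 + d))) := by
    rw [← v1, ← v3, ← integral_add j1 j3, subExt_eq]
    refine Eq.trans ?_ (integral_add i1 (j1.add j3))
    congr 1
    funext x
    rw [lapl_GG hc hf.contDiff]
    ring
  have l2 : subExt d (k + 1) l f = (∫ x, ‖x‖ ^ (-(d:ℝ) - 2 * k - 2) * GG d k c f x)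
      + SS d (2 * k + 2) f * Ic c l := by
    rw [← v2, ← integral_add i2 j2, subExt_eq]
    congr 1
    funext x
    have e1 : -(d:ℝ) - 2 * ((k + 1 : ℕ) : ℝ) = -(d:ℝ) - 2 * k - 2 := by push_cast; ring
    rw [e1, show 2 * (k + 1) = 2 * k + 2 by ring]
    unfold GG
    ring
  rw [l1, l2, e12]
  ring

lemma SS_rec {d k : ℕ} (hd : 3 ≤ d) {f : Eu d → ℝ} (hf : IsSw d f) :
    SS d (2 * k) (lapl d f) = (d + 2 * k) * (2 * k + 2) * SS d (2 * k + 2) f := by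
  have h1 := step_c (k := k) hd (c := 1) (l := 1) le_rfl one_pos hf
  have h2 := step_c (k := k) hd (c := 2) (l := 1) (by norm_num) one_pos hf
  have h3 : (SS d (2 * k) (lapl d f) - (d + 2 * k) * (2 * k + 2) * SS d (2 * k + 2) f)
      * (Ic 1 1 - Ic 2 1) = 0 := by linarith
  rcases mul_eq_zero.1 h3 with h | h
  · linarith
  · exact absurd (sub_eq_zero.1 h) (Ic_diff one_pos)

end

section

open scoped ContDiff

/-- normalised solid angle constant -/
def om (d k : ℕ) : ℝ := OmegaDM d k / ((2 * k).factorial : ℝ)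

lemma om_succ {d k : ℕ} (hd : 3 ≤ d) : om d k = (d + 2 * k) * (2 * k + 2) * om d (k + 1) := by
  have hd' : (3:ℝ) ≤ d := by exact_mod_cast hd
  have g1 : Real.Gamma (((k + 1 : ℕ) : ℝ) + 1 / 2) = (k + 1 / 2) * Real.Gamma ((k:ℝ) + 1 / 2) := by
    rw [← Real.Gamma_add_one (by positivity)]; congr 1; push_cast; ring
  have g2 : Real.Gamma (((k + 1 : ℕ) : ℝ) + (d:ℝ) / 2)
      = (k + (d:ℝ) / 2) * Real.Gamma ((k:ℝ) + (d:ℝ) / 2) := by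
    rw [← Real.Gamma_add_one (by positivity)]; congr 1; push_cast; ring
  have p2 : Real.Gamma ((k:ℝ) + (d:ℝ) / 2) ≠ 0 := (Real.Gamma_pos_of_pos (by positivity)).ne'
  unfold om OmegaDM
  rw [g1, g2, show 2 * (k + 1) = 2 * k + 1 + 1 by ring, Nat.factorial_succ, Nat.factorial_succ]
  have : ((2 * k).factorial : ℝ) ≠ 0 := by positivity
  have h3 : (k:ℝ) + d / 2 ≠ 0 := by positivity
  push_cast
  field_simp
  ring

lemma om_zero {d : ℕ} (hd : 3 ≤ d) :
    om d 0 = (volume : Measure (Eu d)).toSphere.real Set.univ := by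
  have hd' : (3:ℝ) ≤ d := by exact_mod_cast hd
  have : Nonempty (Fin d) := ⟨⟨0, by omega⟩⟩
  have p2 : 0 < Real.Gamma ((d:ℝ) / 2) := Real.Gamma_pos_of_pos (by positivity)
  rw [Measure.toSphere_real_apply_univ, measureReal_def, EuclideanSpace.volume_ball]
  unfold om OmegaDM
  have hg : Real.Gamma ((d:ℝ) / 2 + 1) = (d:ℝ) / 2 * Real.Gamma ((d:ℝ) / 2) :=
    Real.Gamma_add_one (by positivity)
  have hpi : √π * π ^ (((d:ℝ) - 1) / 2) = √π ^ d := by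
    rw [Real.sqrt_eq_rpow, ← Real.rpow_add Real.pi_pos, ← Real.rpow_natCast,
      ← Real.rpow_mul Real.pi_pos.le]
    congr 1; ring
  simp only [Fintype.card_fin, hg, ENNReal.ofReal_one, one_pow, one_mul]
  rw [ENNReal.toReal_ofReal (by positivity), ← hpi]
  have h0 : ((0:ℕ):ℝ) + 1 / 2 = 1 / 2 := by simp
  have h1 : ((0:ℕ):ℝ) + (d:ℝ) / 2 = d / 2 := by simp
  rw [h0, h1, Real.Gamma_one_half_eq]
  have h2 : Module.finrank ℝ (Eu d) = d := by simp
  rw [h2]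
  simp only [mul_zero, Nat.factorial_zero, Nat.cast_one, div_one]
  field_simp

lemma SS_val {d : ℕ} (hd : 3 ≤ d) (k : ℕ) : ∀ {f : Eu d → ℝ}, IsSw d f →
    SS d (2 * k) f = om d k * ((lapl d)^[k] f) 0 := by
  induction k with
  | zero =>
    intro f hf
    unfold SS
    rw [om_zero hd]
    simp [TT_zero]
  | succ k ih =>
    intro f hf
    have hd' : (3:ℝ) ≤ d := by exact_mod_cast hd
    have h1 := ih hf.lapl
    rw [SS_rec hd hf, om_succ hd, mul_assoc ((d + 2 * k : ℝ) * (2 * k + 2))] at h1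
    exact mul_left_cancel₀ (by positivity) h1

lemma one_step {d k : ℕ} (hd : 3 ≤ d) {l : ℝ} (hl : 0 < l) {f : Eu d → ℝ} (hf : IsSw d f) :
    subExt d k l (lapl d f) = (d + 2 * k) * (2 * k + 2) * subExt d (k + 1) l f
      - (4 * k + 2 + d) * (om d (k + 1) * ((lapl d)^[k + 1] f) 0) := by
  rw [step_c hd le_rfl hl hf, SS_rec hd hf, ← SS_val hd (k + 1) hf]
  rw [show 2 * (k + 1) = 2 * k + 2 by ring]
  ring

/-- double factorial prefactor -/
def Cn (d m n : ℕ) : ℝ :=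
  ((d + 2 * m + 2 * n - 2).doubleFactorial : ℝ) / ((d + 2 * m - 2).doubleFactorial : ℝ) *
          (((2 * m + 2 * n).doubleFactorial : ℝ) / ((2 * m).doubleFactorial : ℝ))

lemma Cn_zero (d m : ℕ) : Cn d m 0 = 1 := by
  unfold Cn
  have h1 : ((d + 2 * m - 2).doubleFactorial : ℝ) ≠ 0 := by
    exact_mod_cast (Nat.doubleFactorial_pos _).ne'
  have h2 : ((2 * m).doubleFactorial : ℝ) ≠ 0 := by
    exact_mod_cast (Nat.doubleFactorial_pos _).ne'
  simp [h1, h2]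

lemma Cn_succ {d : ℕ} (hd : 3 ≤ d) (m n : ℕ) :
    Cn d m (n + 1) = Cn d m n * ((d + 2 * (m + n)) * (2 * (m + n) + 2)) := by
  unfold Cn
  rw [show d + 2 * m + 2 * (n + 1) - 2 = (d + 2 * m + 2 * n - 2) + 2 by omega,
    show 2 * m + 2 * (n + 1) = 2 * m + 2 * n + 2 by ring,
    Nat.doubleFactorial_add_two, Nat.doubleFactorial_add_two,
    show d + 2 * m + 2 * n - 2 + 2 = d + 2 * m + 2 * n by omega]
  push_cast
  ring

lemma Cn_om {d : ℕ} (hd : 3 ≤ d) (m n : ℕ) : Cn d m n * om d (m + n) = om d m := by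
  induction n with
  | zero => rw [Cn_zero]; simp
  | succ n ih =>
    rw [← ih, Cn_succ hd, om_succ (k := m + n) hd]
    push_cast
    ring_nf

lemma main_aux {d m : ℕ} (hd : 3 ≤ d) {l : ℝ} (hl : 0 < l) (n : ℕ) :
    ∀ {f : Eu d → ℝ}, IsSw d f →
    subExt d m l ((lapl d)^[n] f) = Cn d m n * subExt d (m + n) l f
      - om d m * (∑ ℓ ∈ Finset.Icc 1 n,
              (4 * (m : ℝ) + 4 * (ℓ : ℝ) + (d : ℝ) - 2) /
                (2 * ((m : ℝ) + (ℓ : ℝ)) * (2 * (m : ℝ) + 2 * (ℓ : ℝ) + (d : ℝ) - 2))) *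
            ((lapl d)^[n + m] f) 0 := by
  induction n with
  | zero => intro f hf; simp [Cn_zero]
  | succ n ih =>
    intro f hf
    have hd' : (3:ℝ) ≤ d := by exact_mod_cast hd
    have e1 : (lapl d)^[n + 1] f = (lapl d)^[n] (lapl d f) := rfl
    have e2 : (lapl d)^[n + m] (lapl d f) = (lapl d)^[m + n + 1] f := by
      rw [add_comm n m]; rfl
    rw [e1, ih hf.lapl, one_step hd hl hf, e2, Finset.sum_Icc_succ_top (by omega),
      show n + 1 + m = m + n + 1 by ring, ← add_assoc m n 1, Cn_succ hd, ← Cn_om hd m n,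
      om_succ (k := m + n) hd]
    have a1 : (m:ℝ) + (n + 1) ≠ 0 := by positivity
    have a2 : (2:ℝ) * m + 2 * (n + 1) + d - 2 ≠ 0 := by
      have : (2:ℝ) * m + 2 * (n + 1) + d - 2 = 2 * m + 2 * n + d := by ring
      rw [this]; positivity
    have a3 : (4 * (m : ℝ) + 4 * ((n + 1 : ℕ) : ℝ) + (d : ℝ) - 2) /
        (2 * ((m : ℝ) + ((n + 1 : ℕ) : ℝ)) * (2 * (m : ℝ) + 2 * ((n + 1 : ℕ) : ℝ) + (d : ℝ) - 2))
        * ((d + 2 * ((m + n : ℕ) : ℝ)) * (2 * ((m + n : ℕ) : ℝ) + 2))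
        = 4 * ((m + n : ℕ) : ℝ) + 2 + d := by
      push_cast
      rw [div_mul_eq_mul_div, div_eq_iff (mul_ne_zero (mul_ne_zero two_ne_zero a1) a2)]
      ring
    generalize (4 * (m : ℝ) + 4 * ((n + 1 : ℕ) : ℝ) + (d : ℝ) - 2) /
        (2 * ((m : ℝ) + ((n + 1 : ℕ) : ℝ)) * (2 * (m : ℝ) + 2 * ((n + 1 : ℕ) : ℝ) + (d : ℝ) - 2))
        = Y at a3 ⊢
    rw [← a3]
    push_cast
    ring

end

/-- the Laplacian identity
`Δ^n R_d[r^{-d-2m}] = [(d+2m+2n-2)!!/(d+2m-2)!!][(2m+2n)!!/(2m)!!] R_d[r^{-d-2m-2n}]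
 - (Ω_{d,m}/(2m)!) Σ_{ℓ=1}^{n} (4m+4ℓ+d-2)/(2(m+ℓ)(2m+2ℓ+d-2)) Δ^{n+m}δ`. -/
theorem stmt_7 (d m n : ℕ) (hd : 3 ≤ d) (hn : 1 ≤ n) (l : ℝ) (hl : 0 < l)
    (φ : SchwartzMap (EuclideanSpace ℝ (Fin d)) ℝ) :
    subExt d m l ((lapl d)^[n] (⇑φ))
      = ((d + 2 * m + 2 * n - 2).doubleFactorial : ℝ) / ((d + 2 * m - 2).doubleFactorial : ℝ) *
          (((2 * m + 2 * n).doubleFactorial : ℝ) / ((2 * m).doubleFactorial : ℝ)) *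
          subExt d (m + n) l (⇑φ)
        - (OmegaDM d m / ((2 * m).factorial : ℝ)) *
            (∑ ℓ ∈ Finset.Icc 1 n,
              (4 * (m : ℝ) + 4 * (ℓ : ℝ) + (d : ℝ) - 2) /
                (2 * ((m : ℝ) + (ℓ : ℝ)) * (2 * (m : ℝ) + 2 * (ℓ : ℝ) + (d : ℝ) - 2))) *
            ((lapl d)^[n + m] (⇑φ)) 0 := by
  exact main_aux hd hl n ⟨φ, rfl⟩

end
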